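/- For the torus control system (lifted to ℝ^d × ℝ^d) with Hamiltonians H_u(q,p) = |p|²/2 + V_0(q) + Σ_{j=1}^d (u_{2j−1} cos(k_j·q) + u_{2j} sin(k_j·q)): for every r ∈ [1,∞), every torus density ρ0, every g ∈ C^∞(ℝ^d, ℝ) and every ε > 0 there exist τ ∈ [0,ε] and a piecewise constant control u(·) on [0,τ] such that ‖ρ0 ∘ Φ^τ_{H_u} − ρ0 ∘ T_g‖_{L^r(Q)} < ε, where T_g is the horizontal shear T_g(q,p) = (q + ∇g(p), p). -/

import Mathlib

open MeasureTheory Real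

noncomputable section

/-- The phase space `T*ℝ^d = ℝ^d × ℝ^d` (positions `q` and momenta `p`),
identified with `ℝ^{2d}` with the sup norm and the Lebesgue (symplectic volume) measure. -/
abbrev Phase (d : ℕ) := (Fin d → ℝ) × (Fin d → ℝ)

/-- The Hamiltonian vector field of a function `H : Phase d → ℝ`:
`H⃗(q,p) = (∂_p H(q,p), −∂_q H(q,p))`. -/
def hamVF {d : ℕ} (H : Phase d → ℝ) (x : Phase d) : Phase d :=
  (fun i => fderiv ℝ H x (0, Pi.single i 1),
   fun i => -(fderiv ℝ H x (Pi.single i 1, 0)))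

/-- `φ` is the global flow of the (complete) vector field `X`. -/
def IsFlowOf {d : ℕ} (X : Phase d → Phase d) (φ : ℝ → Phase d → Phase d) : Prop :=
  (∀ x, φ 0 x = x) ∧ ∀ x t, HasDerivAt (fun s => φ s x) (X (φ t x)) t

/-- `Φ` is a smooth diffeomorphism of phase space. -/
def IsDiffeo {d : ℕ} (Φ : Phase d → Phase d) : Prop :=
  ContDiff ℝ (⊤ : ℕ∞) Φ ∧
    ∃ Ψ, ContDiff ℝ (⊤ : ℕ∞) Ψ ∧ Function.LeftInverse Ψ Φ ∧ Function.RightInverse Ψ Φ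

/-- `Φ` is a Hamiltonian diffeomorphism of `T*ℝ^d`: a smooth diffeomorphism which is the
time-1 flow map of a smooth time-dependent Hamiltonian whose non-autonomous Hamiltonian flow
is defined on `[0,1]` from every initial point. -/
def IsHamDiffeo {d : ℕ} (Φ : Phase d → Phase d) : Prop :=
  IsDiffeo Φ ∧
  ∃ (H : ℝ → Phase d → ℝ) (φ : ℝ → Phase d → Phase d),
    ContDiff ℝ (⊤ : ℕ∞) (fun z : ℝ × Phase d => H z.1 z.2) ∧
    (∀ x, φ 0 x = x) ∧
    (∀ x, ∀ t ∈ Set.Icc (0:ℝ) 1,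
      HasDerivWithinAt (fun s => φ s x) (hamVF (H t) (φ t x)) (Set.Icc (0:ℝ) 1) t) ∧
    Φ = φ 1

/-- `Φ` is the flow map from time `0` to time `τ` of the time-dependent Hamiltonian vector
field `H⃗_{u(t)}` for some piecewise constant control `u(·) : [0,τ] → U` (finitely many
pieces): i.e. `Φ` is a finite composition of flows of the autonomous fields `H⃗_{u_i}`
for nonnegative durations summing to `τ`. -/
def Reachable {d : ℕ} {U : Type*} (Ham : U → Phase d → ℝ) (τ : ℝ)
    (Φ : Phase d → Phase d) : Prop :=
  ∃ (n : ℕ) (dur : Fin n → ℝ) (u : Fin n → U) (φ : Fin n → ℝ → Phase d → Phase d),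
    (∀ i, 0 ≤ dur i) ∧ (∑ i, dur i) = τ ∧
    (∀ i, IsFlowOf (hamVF (Ham (u i))) (φ i)) ∧
    Φ = (List.ofFn (fun i => φ i (dur i))).foldl (fun g f => f ∘ g) id

/-- `‖Φ − Ψ‖_{C^ℓ(K)} < ε`: all iterated derivatives of the difference up to order `ℓ`
are smaller than `ε` on `K`. -/
def CloseCl {d : ℕ} (ℓ : ℕ) (K : Set (Phase d)) (ε : ℝ) (Φ Ψ : Phase d → Phase d) : Prop :=
  ∀ j ≤ ℓ, ∀ x ∈ K, ‖iteratedFDeriv ℝ j (fun y => Φ y - Ψ y) x‖ < ε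

/-- `Ψ ∈ R̄_st`: the diffeomorphism `Ψ` is small-time approximately reachable for the
control system with controlled Hamiltonians `Ham u`, `u ∈ U`. -/
def SmallTimeReachable {d : ℕ} {U : Type*} (Ham : U → Phase d → ℝ)
    (Ψ : Phase d → Phase d) : Prop :=
  ∀ ε > 0, ∀ K : Set (Phase d), IsCompact K → ∀ ℓ : ℕ,
    ∃ τ ∈ Set.Icc (0:ℝ) ε, ∃ Φ, Reachable Ham τ Φ ∧ CloseCl ℓ K ε Φ Ψ

/-- A function `f` with complete Hamiltonian vector field is STAR (small-time approximately
reachable) if its flow at every time `s ∈ ℝ` belongs to `R̄_st`. -/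
def IsSTAR {d : ℕ} {U : Type*} (Ham : U → Phase d → ℝ) (f : Phase d → ℝ) : Prop :=
  (∃ φ, IsFlowOf (hamVF f) φ) ∧
  ∀ φ, IsFlowOf (hamVF f) φ → ∀ s : ℝ, SmallTimeReachable Ham (φ s)

/-- The Poisson bracket `{f,g} = Σ_j (∂_{p_j} f ∂_{q_j} g − ∂_{q_j} f ∂_{p_j} g)`. -/
def poissonBracket {d : ℕ} (f g : Phase d → ℝ) : Phase d → ℝ :=
  fun x => ∑ j, (fderiv ℝ f x (0, Pi.single j 1) * fderiv ℝ g x (Pi.single j 1, 0)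
      - fderiv ℝ f x (Pi.single j 1, 0) * fderiv ℝ g x (0, Pi.single j 1))

/-- The mechanical Hamiltonian `H_u(q,p) = |p|²/2 + V_0(q) + Σ_j u_j V_j(q)`. -/
def mechHam {d m : ℕ} (V0 : (Fin d → ℝ) → ℝ) (V : Fin m → (Fin d → ℝ) → ℝ)
    (u : Fin m → ℝ) : Phase d → ℝ :=
  fun x => (∑ i, (x.2 i) ^ 2) / 2 + V0 x.1 + ∑ j, u j * V j x.1

/-- The Euclidean controlled Hamiltonian
`H_u(q,p) = |p|²/2 + V_0(q) + Σ_{j=1}^d u_j q_j + u_{d+1} e^{−|q|²/2}`,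
with control `u ∈ ℝ^d × ℝ ≃ ℝ^{d+1}`. -/
def eucHam {d : ℕ} (V0 : (Fin d → ℝ) → ℝ) (u : (Fin d → ℝ) × ℝ) : Phase d → ℝ :=
  fun x => (∑ i, (x.2 i) ^ 2) / 2 + V0 x.1 + (∑ j, u.1 j * x.1 j)
    + u.2 * Real.exp (-(∑ i, (x.1 i) ^ 2) / 2)

/-- The frequencies `k_1 = e_1, …, k_{d−1} = e_{d−1}, k_d = (1,…,1)`. -/
def kvec (d : ℕ) (j : Fin d) : Fin d → ℝ :=
  if (j : ℕ) < d - 1 then Pi.single j 1 else fun _ => 1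

/-- The torus controlled Hamiltonian (lifted to `ℝ^d × ℝ^d`)
`H_u(q,p) = |p|²/2 + V_0(q) + Σ_{j=1}^d (u_{2j−1} cos(k_j·q) + u_{2j} sin(k_j·q))`,
with control `u ∈ (ℝ²)^d ≃ ℝ^{2d}`. -/
def torusHam {d : ℕ} (V0 : (Fin d → ℝ) → ℝ) (u : Fin d → ℝ × ℝ) : Phase d → ℝ :=
  fun x => (∑ i, (x.2 i) ^ 2) / 2 + V0 x.1 +
    ∑ j, ((u j).1 * Real.cos (∑ i, kvec d j i * x.1 i) +
          (u j).2 * Real.sin (∑ i, kvec d j i * x.1 i))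

/-- The vertical shear `(q,p) ↦ (q, p − ∇f(q))`. -/
def vshear {d : ℕ} (f : (Fin d → ℝ) → ℝ) : Phase d → Phase d :=
  fun x => (x.1, fun i => x.2 i - fderiv ℝ f x.1 (Pi.single i 1))

/-- The horizontal shear `(q,p) ↦ (q + ∇g(p), p)`. -/
def hshear {d : ℕ} (g : (Fin d → ℝ) → ℝ) : Phase d → Phase d :=
  fun x => (fun i => x.1 i + fderiv ℝ g x.2 (Pi.single i 1), x.2)

/-- `M` is a mesh of size `h`: the closed sup-norm cubes `C̄(m_n,h)` cover `ℝ^{2d}` and the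
open cubes `C(m_n,h)` are pairwise disjoint. -/
def IsMesh {d : ℕ} (h : ℝ) (M : ℕ → Phase d) : Prop :=
  (∀ x : Phase d, ∃ n, ‖x - M n‖ ≤ h) ∧
  ∀ n ℓ : ℕ, n ≠ ℓ →
    Disjoint {x : Phase d | ‖x - M n‖ < h} {x : Phase d | ‖x - M ℓ‖ < h}

/-- `F` is a permutation of the mesh `M` of size `h`: a bijection translating every open
cube of the mesh onto another one. -/
def IsMeshPermutation {d : ℕ} (h : ℝ) (M : ℕ → Phase d) (F : Phase d → Phase d) : Prop :=
  Function.Bijective F ∧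
  ∀ n : ℕ, ∃ ℓ : ℕ, ∀ x : Phase d, ‖x - M n‖ < h → F x = x + (M ℓ - M n)

/-- The fundamental domain `Q = [0,2π)^d × ℝ^d` of `T*𝕋^d` in `ℝ^d × ℝ^d`. -/
def torusBlock (d : ℕ) : Set (Phase d) :=
  {x : Phase d | ∀ i, 0 ≤ x.1 i ∧ x.1 i < 2 * Real.pi}

/-- A torus density of class `L^r`: a measurable function on `ℝ^d × ℝ^d`, `2π`-periodic in
each position variable, with finite `L^r` norm on the fundamental domain `Q`. -/
def IsTorusDensity {d : ℕ} (p : ENNReal) (ρ : Phase d → ℝ) : Prop :=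
  Measurable ρ ∧
  (∀ (q : Fin d → ℝ) (pp : Fin d → ℝ) (k : Fin d → ℤ),
    ρ (fun i => q i + 2 * Real.pi * (k i), pp) = ρ (q, pp)) ∧
  eLpNorm ρ p (volume.restrict (torusBlock d)) < ⊤

end

/-- Gluing solutions on `(-T,T)` to a global one. -/
theorem glue_ode {E : Type*} [NormedAddCommGroup E] [NormedSpace ℝ E] (v : E → E) (K : NNReal)
    (hv : LipschitzWith K v) (x : E)
    (h : ∀ T : ℝ, 0 < T → ∃ α : ℝ → E, α 0 = x ∧ ∀ t ∈ Set.Ioo (-T) T, HasDerivAt α (v (α t)) t) :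
    ∃ γ : ℝ → E, γ 0 = x ∧ ∀ t, HasDerivAt γ (v (γ t)) t := by
  choose! α h0 hα using h
  have key : ∀ S T : ℝ, 0 < S → S ≤ T → ∀ t ∈ Set.Ioo (-S) S, α S t = α T t := by
    intro S T hS hST t ht
    have := ODE_solution_unique_of_mem_Ioo (v := fun _ => v) (s := fun _ => Set.univ) (K := K)
      (f := α S) (g := α T) (a := -S) (b := S) (t₀ := 0)
      (fun t _ => hv.lipschitzOnWith) (by constructor <;> linarith)
      (fun t ht => ⟨hα S hS t ht, trivial⟩)
      (fun t ht => ⟨hα T (by linarith) t (by constructor <;> linarith [ht.1, ht.2]), trivial⟩)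
      (by rw [h0 S hS, h0 T (by linarith)])
    exact this ht
  have key2 : ∀ S T : ℝ, 0 < S → 0 < T → ∀ t, |t| < S → |t| < T → α S t = α T t := by
    intro S T hS hT t h1 h2
    rcases le_total S T with h | h
    · exact key S T hS h t (abs_lt.1 h1)
    · exact (key T S hT h t (abs_lt.1 h2)).symm
  refine ⟨fun t => α (|t| + 1) t, ?_, ?_⟩
  · exact h0 _ (by positivity)
  · intro t
    have h1 := hα (|t| + 1) (by positivity) t (abs_lt.1 (by linarith))
    refine h1.congr_of_eventuallyEq ?_
    have : ∀ᶠ s in nhds t, |s| < |t| + 1 := (continuous_abs.continuousAt).eventually_lt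
      continuousAt_const (by linarith)
    filter_upwards [this] with s hs
    exact key2 _ _ (by positivity) (by positivity) s (by linarith) hs

/-- The second order field `(q,p) ↦ (p, a(q))`. -/
def fld {d : ℕ} (a : (Fin d → ℝ) → (Fin d → ℝ)) (x : Phase d) : Phase d := (x.2, a x.1)

theorem fld_lipschitz {d : ℕ} (a : (Fin d → ℝ) → (Fin d → ℝ)) (K : NNReal)
    (ha : LipschitzWith K a) : LipschitzWith (max 1 K) (fld a) := by
  have h1 : LipschitzWith (1 * 1) (fun x : Phase d => x.2) := by
    simpa using LipschitzWith.prod_snd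
  have h2 : LipschitzWith (K * 1) (fun x : Phase d => a x.1) := ha.comp LipschitzWith.prod_fst
  have h3 := h1.prodMk h2
  simp only [mul_one] at h3
  exact h3

theorem exists_flow {d : ℕ} (a : (Fin d → ℝ) → (Fin d → ℝ)) (C K : NNReal)
    (hC : ∀ q, ‖a q‖ ≤ C) (ha : LipschitzWith K a) : ∃ φ, IsFlowOf (fld a) φ := by
  have main : ∀ x : Phase d, ∃ γ : ℝ → Phase d, γ 0 = x ∧ ∀ t, HasDerivAt γ (fld a (γ t)) t := by
    intro x
    refine glue_ode (fld a) _ (fld_lipschitz a K ha) x ?_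
    intro T hT
    -- field in the variables `(q - t p, p)`
    let f : ℝ → Phase d → Phase d := fun t z => (-(t • a (z.1 + t • z.2)), a (z.1 + t • z.2))
    let t0 : Set.Icc (-T) T := ⟨0, by constructor <;> linarith⟩
    obtain ⟨T', hT'⟩ : ∃ T' : NNReal, (T' : ℝ) = T := ⟨⟨T, hT.le⟩, rfl⟩
    have hac := ha.continuous
    have hlipa : ∀ t ∈ Set.Icc (-T) T, LipschitzWith (K * (1 + T')) 
        (fun z : Phase d => a (z.1 + t • z.2)) := by
      intro t ht
      apply ha.comp
      apply LipschitzWith.of_dist_le_mul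
      intro z w
      rw [dist_eq_norm, dist_eq_norm]
      have e : z.1 + t • z.2 - (w.1 + t • w.2) = (z - w).1 + t • (z - w).2 := by
        simp [smul_sub]; abel
      rw [e]
      have ht' : |t| ≤ T := abs_le.2 ht
      calc _ ≤ ‖(z-w).1‖ + ‖t • (z-w).2‖ := norm_add_le _ _
        _ ≤ ‖z-w‖ + T * ‖z - w‖ := by
            rw [norm_smul, Real.norm_eq_abs]
            gcongr
            · exact norm_fst_le _
            · exact norm_snd_le _
        _ = _ := by push_cast; rw [hT']; ring
    have hPL : IsPicardLindelof f t0 x ((C * (1 + T')) * T') 0 (C * (1 + T'))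
        (max (T' * (K * (1 + T'))) (K * (1 + T'))) := by
      constructor
      · intro t ht
        apply LipschitzWith.lipschitzOnWith
        refine LipschitzWith.prodMk ?_ (hlipa t ht)
        apply LipschitzWith.of_dist_le_mul
        intro z w
        rw [dist_neg_neg, dist_smul₀]
        have h1 := (hlipa t ht).dist_le_mul z w
        have ht' : |t| ≤ T := abs_le.2 ht
        calc _ ≤ T * (((K * (1 + T') : NNReal) : ℝ) * dist z w) := by
              rw [Real.norm_eq_abs]; gcongr
          _ = _ := by push_cast; rw [hT']; ring
      · intro z _
        apply Continuous.continuousOn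
        fun_prop
      · intro t ht z _
        have ht' : |t| ≤ T := abs_le.2 ht
        have hc := hC (z.1 + t • z.2)
        simp only [f, Prod.norm_def, norm_neg, norm_smul, Real.norm_eq_abs]
        have : (((C * (1 + T') : NNReal)) : ℝ) = C * (1 + T) := by push_cast; rw [hT']
        rw [this]
        apply max_le
        · calc _ ≤ T * C := by gcongr
            _ ≤ _ := by nlinarith [C.2]
        · refine hc.trans ?_
          nlinarith [C.2, mul_nonneg C.2 hT.le]
      · simp [t0, hT']
    obtain ⟨α, hα0, hα⟩ := hPL.exists_eq_forall_mem_Icc_hasDerivWithinAt₀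
    refine ⟨fun t => ((α t).1 + t • (α t).2, (α t).2), ?_, ?_⟩
    · have : α 0 = x := hα0
      simp [this]
    · intro t ht
      have h1 : HasDerivAt α (f t (α t)) t :=
        (hα t ⟨ht.1.le, ht.2.le⟩).hasDerivAt (Icc_mem_nhds ht.1 ht.2)
      have h2 : HasDerivAt (fun t => (α t).1) (f t (α t)).1 t := h1.fst
      have h3 : HasDerivAt (fun t => (α t).2) (f t (α t)).2 t := h1.snd
      have h4 := h2.add ((hasDerivAt_id t).smul h3)
      have h5 := h4.prodMk h3
      convert! h5 using 1
      simp [fld, f]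
  choose φ h0 h1 using main
  exact ⟨fun t x => φ x t, h0, h1⟩

open MeasureTheory Real

/-- lattice shift in `ℝ^d` -/
noncomputable def sh {d : ℕ} (k : Fin d → ℤ) (q : Fin d → ℝ) : Fin d → ℝ := fun i => q i + 2 * Real.pi * (k i)

/-- lattice shift in phase space -/
noncomputable def tsh {d : ℕ} (k : Fin d → ℤ) (x : Phase d) : Phase d := (sh k x.1, x.2)

theorem sh_eq {d : ℕ} (k : Fin d → ℤ) (q : Fin d → ℝ) :
    sh k q = q + fun i => 2 * Real.pi * (k i : ℝ) := rfl

instance {d : ℕ} : (volume : Measure (Phase d)).IsAddHaarMeasure :=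
  Measure.prod.instIsAddHaarMeasure (volume : Measure (Fin d → ℝ)) (volume : Measure (Fin d → ℝ))

theorem lipschitz_volume {d : ℕ} (f : Phase d → Phase d) (K : NNReal) (hf : LipschitzWith K f)
    (B : Set (Phase d)) :
    volume (f '' B) ≤ (K : ENNReal) ^ (2 * d) * volume B := by
  let n : ℝ := (Module.finrank ℝ (Phase d) : ℝ)
  have hn : n = ((2 * d : ℕ) : ℝ) := by
    simp [n, two_mul]
  have h1 := hf.hausdorffMeasure_image_le (d := n) (by positivity) B
  have h2 : (volume : Measure (Phase d)) =
      (volume : Measure (Phase d)).addHaarScalarFactor (Measure.hausdorffMeasure n) •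
        Measure.hausdorffMeasure n :=
    Measure.isAddLeftInvariant_eq_smul _ _
  rw [h2, Measure.smul_apply, Measure.smul_apply]
  have h3 : (K : ENNReal) ^ n = (K : ENNReal) ^ (2 * d) := by rw [hn, ENNReal.rpow_natCast]
  rw [h3] at h1
  generalize (volume : Measure (Phase d)).addHaarScalarFactor (Measure.hausdorffMeasure n) = c
  simp only [ENNReal.smul_def, smul_eq_mul]
  calc _ ≤ _ * ((K : ENNReal) ^ (2 * d) * _) := mul_le_mul_right h1 _
    _ = _ := by ring

theorem flow_unique {d : ℕ} {a : (Fin d → ℝ) → (Fin d → ℝ)} {K : NNReal}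
    (ha : LipschitzWith K a) {φ : ℝ → Phase d → Phase d} (hφ : IsFlowOf (fld a) φ)
    (γ : ℝ → Phase d) (hγ : ∀ t, HasDerivAt γ (fld a (γ t)) t) :
    ∀ t, γ t = φ t (γ 0) := by
  have := ODE_solution_unique_univ (v := fun _ => fld a) (s := fun _ => Set.univ) (K := max 1 K)
    (f := γ) (g := fun t => φ t (γ 0)) (t₀ := 0)
    (fun t => (fld_lipschitz a K ha).lipschitzOnWith) (fun t => ⟨hγ t, trivial⟩)
    (fun t => ⟨hφ.2 _ t, trivial⟩) (by simp [hφ.1])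
  intro t
  exact congrFun this t

theorem flow_add {d : ℕ} {a : (Fin d → ℝ) → (Fin d → ℝ)} {K : NNReal}
    (ha : LipschitzWith K a) {φ : ℝ → Phase d → Phase d} (hφ : IsFlowOf (fld a) φ)
    (s t : ℝ) (x : Phase d) : φ (t + s) x = φ t (φ s x) := by
  have := flow_unique ha hφ (fun t => φ (t + s) x) (fun t => by
    have := (hφ.2 x (t + s)).comp_add_const t s
    exact this) t
  simpa using this

theorem flow_left_inv {d : ℕ} {a : (Fin d → ℝ) → (Fin d → ℝ)} {K : NNReal}
    (ha : LipschitzWith K a) {φ : ℝ → Phase d → Phase d} (hφ : IsFlowOf (fld a) φ)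
    (t : ℝ) (x : Phase d) : φ (-t) (φ t x) = x := by
  rw [← flow_add ha hφ, neg_add_cancel, hφ.1]

theorem flow_right_inv {d : ℕ} {a : (Fin d → ℝ) → (Fin d → ℝ)} {K : NNReal}
    (ha : LipschitzWith K a) {φ : ℝ → Phase d → Phase d} (hφ : IsFlowOf (fld a) φ)
    (t : ℝ) (x : Phase d) : φ t (φ (-t) x) = x := by
  rw [← flow_add ha hφ, add_neg_cancel, hφ.1]

theorem flow_tsh {d : ℕ} {a : (Fin d → ℝ) → (Fin d → ℝ)} {K : NNReal}
    (ha : LipschitzWith K a) {φ : ℝ → Phase d → Phase d} (hφ : IsFlowOf (fld a) φ)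
    (hper : ∀ q k, a (sh k q) = a q) (k : Fin d → ℤ) (t : ℝ) (x : Phase d) :
    φ t (tsh k x) = tsh k (φ t x) := by
  have := flow_unique ha hφ (fun t => tsh k (φ t x)) (fun t => by
    have h1 := hφ.2 x t
    have h2 : HasDerivAt (fun s => (φ s x).1) _ t := h1.fst
    have h3 : HasDerivAt (fun s => (φ s x).2) _ t := h1.snd
    have h4 := (h2.add_const (fun i => 2 * Real.pi * (k i : ℝ))).prodMk h3
    convert! h4 using 1
    simp [fld, tsh, hper]) t
  rw [this]; simp [hφ.1]

theorem flow_back_lip {d : ℕ} {a : (Fin d → ℝ) → (Fin d → ℝ)} {K : NNReal}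
    (ha : LipschitzWith K a) {φ : ℝ → Phase d → Phase d} (hφ : IsFlowOf (fld a) φ)
    (l : ℝ) (hl : 0 < l) (M : NNReal) (hM1 : l⁻¹ ≤ M) (hM2 : l * K ≤ M)
    (t : ℝ) (ht : 0 ≤ t) (x y : Phase d) :
    dist ((φ (-t) x).1, l • (φ (-t) x).2) ((φ (-t) y).1, l • (φ (-t) y).2) ≤
      dist (x.1, l • x.2) (y.1, l • y.2) * exp (M * t) := by
  let v : Phase d → Phase d := fun z => (-(l⁻¹ • z.2), -(l • a z.1))
  have hv : LipschitzWith M v := by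
    apply LipschitzWith.of_dist_le_mul
    intro z w
    simp only [v, Prod.dist_eq, dist_neg_neg, dist_smul₀, norm_inv, Real.norm_of_nonneg hl.le]
    apply max_le
    · exact mul_le_mul hM1 (le_max_right _ _) dist_nonneg M.2
    · calc l * dist (a z.1) (a w.1) ≤ l * (K * dist z.1 w.1) := by
            gcongr; exact ha.dist_le_mul _ _
        _ = (l * K) * dist z.1 w.1 := by ring
        _ ≤ _ := mul_le_mul hM2 (le_max_left _ _) dist_nonneg M.2
  have hd : ∀ x t, HasDerivAt (fun t => (((φ (-t) x).1, l • (φ (-t) x).2) : Phase d))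
      (v ((φ (-t) x).1, l • (φ (-t) x).2)) t := by
    intro x t
    have h1 := (hφ.2 x (-t)).scomp t (hasDerivAt_neg t)
    have h2 : HasDerivAt (fun s => (φ (-s) x).1) _ t := h1.fst
    have h3 : HasDerivAt (fun s => (φ (-s) x).2) _ t := h1.snd
    have h4 := h2.prodMk (h3.const_smul l)
    convert! h4 using 1
    simp [v, fld, hl.ne']
  have := dist_le_of_trajectories_ODE (v := fun _ => v) (K := M) (a := 0) (b := t)
    (f := fun t => (((φ (-t) x).1, l • (φ (-t) x).2) : Phase d))
    (g := fun t => (((φ (-t) y).1, l • (φ (-t) y).2) : Phase d))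
    (δ := dist (x.1, l • x.2) (y.1, l • y.2)) (fun _ => hv)
    (fun t _ => (hd x t).continuousAt.continuousWithinAt)
    (fun t _ => (hd x t).hasDerivWithinAt)
    (fun t _ => (hd y t).continuousAt.continuousWithinAt)
    (fun t _ => (hd y t).hasDerivWithinAt) (by simp [hφ.1]) t ⟨ht, le_rfl⟩
  simpa using this

theorem flow_continuous {d : ℕ} {a : (Fin d → ℝ) → (Fin d → ℝ)} {K : NNReal}
    (ha : LipschitzWith K a) {φ : ℝ → Phase d → Phase d} (hφ : IsFlowOf (fld a) φ)
    (t : ℝ) (ht : 0 ≤ t) : Continuous (φ (-t)) := by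
  have h : LipschitzWith (Real.toNNReal (exp ((max 1 K : NNReal) * t))) (φ (-t)) := by
    apply LipschitzWith.of_dist_le_mul
    intro x y
    have := flow_back_lip ha hφ 1 one_pos (max 1 K) (by simp) (by simp) t ht x y
    simp only [one_smul] at this
    rw [Real.coe_toNNReal _ (exp_pos _).le, mul_comm]
    exact this
  exact h.continuous

theorem flow_continuous' {d : ℕ} {a : (Fin d → ℝ) → (Fin d → ℝ)} {K : NNReal}
    (ha : LipschitzWith K a) {φ : ℝ → Phase d → Phase d} (hφ : IsFlowOf (fld a) φ)
    (t : ℝ) : Continuous (φ t) := by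
  rcases le_total t 0 with h | h
  · simpa using flow_continuous ha hφ (-t) (by linarith)
  · -- reverse the flow: (q,p) -> (q,-p)
    have h2 : IsFlowOf (fld a) (fun s x => ((φ (-s) (x.1, -x.2)).1, -(φ (-s) (x.1, -x.2)).2)) := by
      refine ⟨fun x => by simp [hφ.1], fun x s => ?_⟩
      have h1 := (hφ.2 (x.1, -x.2) (-s)).scomp s (hasDerivAt_neg s)
      have h2 : HasDerivAt (fun s => (φ (-s) (x.1, -x.2)).1) _ s := h1.fst
      have h3 : HasDerivAt (fun s => (φ (-s) (x.1, -x.2)).2) _ s := h1.snd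
      have h4 := h2.prodMk h3.neg
      convert! h4 using 1
      simp [fld]
    have h3 := flow_continuous ha h2 t h
    simp only [neg_neg] at h3
    have h4 : φ t = fun x => (((fun x : Phase d => (((φ t (x.1, -x.2)).1, -(φ t (x.1, -x.2)).2) : Phase d)) (x.1, -x.2)).1,
        -((fun x : Phase d => (((φ t (x.1, -x.2)).1, -(φ t (x.1, -x.2)).2) : Phase d)) (x.1, -x.2)).2) := by
      funext x; simp
    rw [h4]
    have h5 := h3.comp (continuous_fst.prodMk continuous_snd.neg : Continuous fun x : Phase d => (x.1, -x.2))
    exact h5.fst.prodMk h5.snd.neg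

theorem flow_map_le {d : ℕ} {a : (Fin d → ℝ) → (Fin d → ℝ)} {K : NNReal}
    (ha : LipschitzWith K a) {φ : ℝ → Phase d → Phase d} (hφ : IsFlowOf (fld a) φ)
    (l : ℝ) (hl : 0 < l) (M : NNReal) (hM1 : l⁻¹ ≤ M) (hM2 : l * K ≤ M)
    (t : ℝ) (ht : 0 ≤ t) :
    Measure.map (φ t) volume ≤ (ENNReal.ofReal (exp (M * t))) ^ (2 * d) • (volume : Measure (Phase d)) := by
  refine Measure.le_iff.2 fun A hA => ?_
  rw [Measure.map_apply (flow_continuous' ha hφ t).measurable hA, Measure.smul_apply, smul_eq_mul]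
  have e1 : φ t ⁻¹' A = φ (-t) '' A := by
    ext x
    constructor
    · intro hx; exact ⟨φ t x, hx, flow_left_inv ha hφ t x⟩
    · rintro ⟨y, hy, rfl⟩
      simpa [flow_right_inv ha hφ t y] using hy
  rw [e1]
  let D : ℝ → Phase d →ₗ[ℝ] Phase d := fun c =>
    LinearMap.prodMap LinearMap.id (c • LinearMap.id)
  have hD : ∀ c x, D c x = (x.1, c • x.2) := fun c x => rfl
  have hDD : D l⁻¹ ∘ₗ D l = LinearMap.id := by
    ext x <;> simp [hD, hl.ne']
  have hDD' : ∀ x, D l⁻¹ (D l x) = x := fun x => LinearMap.congr_fun hDD x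
  let Ψ : Phase d → Phase d := fun z => D l (φ (-t) (D l⁻¹ z))
  have hΨ : LipschitzWith (Real.toNNReal (exp (M * t))) Ψ := by
    apply LipschitzWith.of_dist_le_mul
    intro x y
    rw [Real.coe_toNNReal _ (exp_pos _).le, mul_comm]
    have := flow_back_lip ha hφ l hl M hM1 hM2 t ht (D l⁻¹ x) (D l⁻¹ y)
    simpa [Ψ, hD, hl.ne'] using this
  have e2 : φ (-t) '' A = D l⁻¹ '' (Ψ '' (D l '' A)) := by
    simp only [Set.image_image, Ψ, hDD']
  rw [e2, Measure.addHaar_image_linearMap]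
  have h3 := lipschitz_volume Ψ _ hΨ (D l '' A)
  rw [Measure.addHaar_image_linearMap] at h3
  have hdet : ENNReal.ofReal |LinearMap.det (D l⁻¹)| * ENNReal.ofReal |LinearMap.det (D l)| = 1 := by
    rw [← ENNReal.ofReal_mul (abs_nonneg _), ← abs_mul, ← LinearMap.det_comp, hDD]
    simp
  calc _ ≤ ENNReal.ofReal |LinearMap.det (D l⁻¹)| * _ := mul_le_mul_right h3 _
    _ = (ENNReal.ofReal |LinearMap.det (D l⁻¹)| * ENNReal.ofReal |LinearMap.det (D l)|) *
        ((ENNReal.ofReal (exp (M * t))) ^ (2 * d) * volume A) := by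
          have : ((Real.toNNReal (exp (M * t)) : NNReal) : ENNReal) = ENNReal.ofReal (exp (M * t)) := rfl
          rw [this]; ring
    _ = _ := by rw [hdet, one_mul]

open MeasureTheory Real

/-- `G` is a measurable torus-equivariant map contracting integrals of periodic functions up to
the factor `C`. -/
structure Good {d : ℕ} (C : ENNReal) (G : Phase d → Phase d) : Prop where
  meas : Measurable G
  eqv : ∀ k x, G (tsh k x) = tsh k (G x)
  bd : ∀ f : Phase d → ENNReal, Measurable f → (∀ k x, f (tsh k x) = f x) →
    ∫⁻ x in torusBlock d, f (G x) ≤ C * ∫⁻ x in torusBlock d, f x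

/-- exact version -/
structure Exact {d : ℕ} (G : Phase d → Phase d) : Prop where
  good : Good 1 G
  ge : ∀ f : Phase d → ENNReal, Measurable f → (∀ k x, f (tsh k x) = f x) →
    ∫⁻ x in torusBlock d, f x ≤ ∫⁻ x in torusBlock d, f (G x)

theorem Good.comp {d : ℕ} {C D : ENNReal} {G H : Phase d → Phase d} (hG : Good C G)
    (hH : Good D H) : Good (C * D) (G ∘ H) where
  meas := hG.meas.comp hH.meas
  eqv k x := by simp [hH.eqv, hG.eqv]
  bd f hf hp := by
    refine (hH.bd (fun x => f (G x)) (hf.comp hG.meas) (fun k x => by rw [hG.eqv, hp])).trans ?_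
    refine (mul_le_mul_right (hG.bd f hf hp) D).trans ?_
    rw [← mul_assoc, mul_comm D C]

theorem Good.mono {d : ℕ} {C D : ENNReal} {G : Phase d → Phase d} (hG : Good C G) (h : C ≤ D) :
    Good D G where
  meas := hG.meas
  eqv := hG.eqv
  bd f hf hp := (hG.bd f hf hp).trans (mul_le_mul_left h _)

theorem good_id {d : ℕ} : Good 1 (id : Phase d → Phase d) where
  meas := measurable_id
  eqv _ _ := rfl
  bd _ _ _ := by simp

theorem Exact.of_inv {d : ℕ} {G H : Phase d → Phase d} (hG : Good 1 G) (hH : Good 1 H)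
    (h : ∀ x, G (H x) = x) : Exact G where
  good := hG
  ge f hf hp := by
    have := hH.bd (fun x => f (G x)) (hf.comp hG.meas) (fun k x => by rw [hG.eqv, hp])
    simpa [h] using this

/-- the lattice -/
def latt (d : ℕ) : AddSubgroup (Phase d) where
  carrier := {x | ∃ k : Fin d → ℤ, x = (fun i => 2 * Real.pi * (k i), 0)}
  add_mem' := by
    rintro _ _ ⟨k, rfl⟩ ⟨l, rfl⟩
    refine ⟨k + l, ?_⟩
    ext i <;> simp [mul_add]
  zero_mem' := ⟨0, by ext i <;> simp⟩
  neg_mem' := by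
    rintro _ ⟨k, rfl⟩
    refine ⟨-k, ?_⟩
    ext i <;> simp

theorem tsh_eq {d : ℕ} (k : Fin d → ℤ) (x : Phase d) :
    tsh k x = (fun i => 2 * Real.pi * (k i), 0) + x := by
  ext i <;> simp [tsh, sh, add_comm]

instance latt_countable (d : ℕ) : Countable (latt d) := by
  have : Function.Surjective (fun k : Fin d → ℤ =>
      (⟨(fun i => 2 * Real.pi * (k i), 0), k, rfl⟩ : latt d)) := by
    rintro ⟨_, k, rfl⟩
    exact ⟨k, rfl⟩
  exact this.countable

theorem measurableSet_torusBlock (d : ℕ) : MeasurableSet (torusBlock d) := by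
  unfold torusBlock
  simp only [Set.ofPred_forall, Set.ofPred_and]
  refine MeasurableSet.iInter fun i => ?_
  have : Measurable (fun x : Phase d => x.1 i) := (measurable_pi_apply i).comp measurable_fst
  exact (measurableSet_le measurable_const this).inter (measurableSet_lt this measurable_const)

theorem exists_shift {d : ℕ} (x : Phase d) : ∃ k : Fin d → ℤ, tsh k x ∈ torusBlock d := by
  refine ⟨fun i => -⌊x.1 i / (2 * Real.pi)⌋, fun i => ?_⟩
  have hpi : 0 < 2 * Real.pi := by positivity
  simp only [tsh, sh]
  push_cast
  have h1 := Int.floor_le (x.1 i / (2 * Real.pi))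
  have h2 := Int.lt_floor_add_one (x.1 i / (2 * Real.pi))
  rw [le_div_iff₀ hpi] at h1
  rw [div_lt_iff₀ hpi] at h2
  constructor <;> nlinarith

theorem shift_unique {d : ℕ} (x : Phase d) (k l : Fin d → ℤ) (hk : tsh k x ∈ torusBlock d)
    (hl : tsh l x ∈ torusBlock d) : k = l := by
  funext i
  have hpi : 0 < 2 * Real.pi := by positivity
  have h1 := hk i
  have h2 := hl i
  simp only [tsh, sh] at h1 h2
  have h3 : ((k i : ℝ) - l i) < 1 := by
    by_contra h; push Not at h; nlinarith [mul_le_mul_of_nonneg_left h hpi.le]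
  have h4 : ((l i : ℝ) - k i) < 1 := by
    by_contra h; push Not at h; nlinarith [mul_le_mul_of_nonneg_left h hpi.le]
  have h5 : k i - l i < 1 := by exact_mod_cast h3
  have h6 : l i - k i < 1 := by exact_mod_cast h4
  omega

theorem fund_of {d : ℕ} {Φ Ψ : Phase d → Phase d} (hΨ : Measurable Ψ)
    (he : ∀ k x, Ψ (tsh k x) = tsh k (Ψ x)) :
    IsAddFundamentalDomain (latt d) (Ψ ⁻¹' torusBlock d) volume := by
  refine IsAddFundamentalDomain.mk' (hΨ (measurableSet_torusBlock d)).nullMeasurableSet fun x => ?_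
  obtain ⟨k, hk⟩ := exists_shift (Ψ x)
  refine ⟨⟨(fun i => 2 * Real.pi * (k i), 0), k, rfl⟩, ?_, ?_⟩
  · show Ψ ((fun i => 2 * Real.pi * (k i), 0) + x) ∈ torusBlock d
    rw [← tsh_eq, he]; exact hk
  · rintro ⟨_, l, rfl⟩ hl
    have hl' : Ψ ((fun i => 2 * Real.pi * (l i), 0) + x) ∈ torusBlock d := hl
    rw [← tsh_eq, he] at hl'
    have := shift_unique _ _ _ hk hl'
    subst this; rfl

theorem good_of_map_le {d : ℕ} {C : ENNReal} {Φ Ψ : Phase d → Phase d} (hΦ : Measurable Φ)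
    (hΨ : Measurable Ψ) (h1 : ∀ x, Ψ (Φ x) = x) (h2 : ∀ x, Φ (Ψ x) = x)
    (he : ∀ k x, Φ (tsh k x) = tsh k (Φ x)) (hC : Measure.map Φ volume ≤ C • volume) :
    Good C Φ where
  meas := hΦ
  eqv := he
  bd f hf hp := by
    have he' : ∀ k x, Ψ (tsh k x) = tsh k (Ψ x) := by
      intro k x
      rw [← h1 (tsh k (Ψ x)), he, h2]
    have f1 := fund_of (Φ := Φ) hΨ he'
    have f2 : IsAddFundamentalDomain (latt d) (torusBlock d) volume :=
      fund_of (Φ := Φ) (Ψ := id) measurable_id (fun _ _ => rfl)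
    have e1 : torusBlock d = Φ ⁻¹' (Ψ ⁻¹' torusBlock d) := by
      ext x; simp [h1]
    have e2 : ∫⁻ x in Ψ ⁻¹' torusBlock d, f x = ∫⁻ x in torusBlock d, f x := by
      refine f1.setLIntegral_eq f2 f ?_
      rintro ⟨_, k, rfl⟩ x
      show f ((fun i => 2 * Real.pi * (k i), 0) + x) = _
      rw [← tsh_eq, hp]
    calc ∫⁻ x in torusBlock d, f (Φ x)
        = ∫⁻ x in Φ ⁻¹' (Ψ ⁻¹' torusBlock d), f (Φ x) := by rw [← e1]
      _ = ∫⁻ x in Ψ ⁻¹' torusBlock d, f x ∂(Measure.map Φ volume) :=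
          (setLIntegral_map (hΨ (measurableSet_torusBlock d)) hf hΦ).symm
      _ ≤ ∫⁻ x in Ψ ⁻¹' torusBlock d, f x ∂(C • volume) :=
          lintegral_mono' (Measure.restrict_mono le_rfl hC) le_rfl
      _ = C * ∫⁻ x in Ψ ⁻¹' torusBlock d, f x := by
          rw [Measure.restrict_smul, lintegral_smul_measure, smul_eq_mul]
      _ = _ := by rw [e2]

/-- vertical shear by a field -/
def VS {d : ℕ} (w : (Fin d → ℝ) → (Fin d → ℝ)) (x : Phase d) : Phase d := (x.1, x.2 + w x.1)

/-- horizontal shear by a field -/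
def HS {d : ℕ} (v : (Fin d → ℝ) → (Fin d → ℝ)) (x : Phase d) : Phase d := (x.1 + v x.2, x.2)

theorem VS_mp {d : ℕ} {w : (Fin d → ℝ) → (Fin d → ℝ)} (hw : Measurable w) :
    MeasurePreserving (VS w) (volume : Measure (Phase d)) volume := by
  have := (MeasurePreserving.id (volume : Measure (Fin d → ℝ))).skew_product
    (μc := (volume : Measure (Fin d → ℝ))) (μd := (volume : Measure (Fin d → ℝ)))
    (g := fun q p => p + w q) (by
      have : Measurable fun x : Phase d => x.2 + w x.1 :=
        measurable_snd.add (hw.comp measurable_fst)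
      exact this) (Filter.Eventually.of_forall fun q => (measurePreserving_add_right volume (w q)).map_eq)
  exact this

theorem HS_mp {d : ℕ} {w : (Fin d → ℝ) → (Fin d → ℝ)} (hw : Measurable w) :
    MeasurePreserving (HS w) (volume : Measure (Phase d)) volume := by
  have h : MeasurePreserving (Prod.swap : Phase d → Phase d) volume volume :=
    Measure.measurePreserving_swap (μ := (volume : Measure (Fin d → ℝ))) (ν := (volume : Measure (Fin d → ℝ)))
  exact h.comp ((VS_mp hw).comp h)

theorem VS_good {d : ℕ} {w : (Fin d → ℝ) → (Fin d → ℝ)} (hw : Measurable w)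
    (hp : ∀ k q, w (sh k q) = w q) : Good 1 (VS w) := by
  refine good_of_map_le (Ψ := VS (fun q => - w q)) (VS_mp hw).measurable (VS_mp hw.neg).measurable
    (fun x => by simp [VS]) (fun x => by simp [VS]) (fun k x => by simp [VS, tsh, hp]) ?_
  rw [(VS_mp hw).map_eq, one_smul]

theorem HS_good {d : ℕ} {w : (Fin d → ℝ) → (Fin d → ℝ)} (hw : Measurable w) : Good 1 (HS w) := by
  refine good_of_map_le (Ψ := HS (fun q => - w q)) (HS_mp hw).measurable (HS_mp hw.neg).measurable
    (fun x => by simp [HS]) (fun x => by simp [HS])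
    (fun k x => by ext i <;> simp [HS, tsh, sh]; ring) ?_
  rw [(HS_mp hw).map_eq, one_smul]

theorem VS_exact {d : ℕ} {w : (Fin d → ℝ) → (Fin d → ℝ)} (hw : Measurable w)
    (hp : ∀ k q, w (sh k q) = w q) : Exact (VS w) :=
  Exact.of_inv (VS_good hw hp) (VS_good (w := fun q => - w q) hw.neg (fun k q => by simp [hp]))
    (fun x => by simp [VS])

theorem HS_exact {d : ℕ} {w : (Fin d → ℝ) → (Fin d → ℝ)} (hw : Measurable w) : Exact (HS w) :=
  Exact.of_inv (HS_good hw) (HS_good (w := fun q => - w q) hw.neg) (fun x => by simp [HS])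

theorem flow_good {d : ℕ} {a : (Fin d → ℝ) → (Fin d → ℝ)} {K : NNReal}
    (ha : LipschitzWith K a) {φ : ℝ → Phase d → Phase d} (hφ : IsFlowOf (fld a) φ)
    (hper : ∀ q k, a (sh k q) = a q)
    (l : ℝ) (hl : 0 < l) (M : NNReal) (hM1 : l⁻¹ ≤ M) (hM2 : l * K ≤ M)
    (t : ℝ) (ht : 0 ≤ t) : Good ((ENNReal.ofReal (exp (M * t))) ^ (2 * d)) (φ t) :=
  good_of_map_le (flow_continuous' ha hφ t).measurable (flow_continuous' ha hφ (-t)).measurable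
    (flow_left_inv ha hφ t) (flow_right_inv ha hφ t) (fun k x => flow_tsh ha hφ hper k t x)
    (flow_map_le ha hφ l hl M hM1 hM2 t ht)

open MeasureTheory Real

open Filter Topology in
theorem pratt {α : Type*} [MeasurableSpace α] (μ : Measure α) (r : ℝ) (hr : 1 ≤ r)
    (f : ℕ → α → ℝ) (g : α → ℝ) (hf : ∀ n, Measurable (f n)) (hg : Measurable g)
    (hlim : ∀ᵐ x ∂μ, Tendsto (fun n => f n x) atTop (𝓝 (g x)))
    (hI : ∫⁻ x, ‖g x‖ₑ ^ r ∂μ ≠ ⊤) (C : ℕ → ENNReal) (hC : Tendsto C atTop (𝓝 1))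
    (hle : ∀ n, ∫⁻ x, ‖f n x‖ₑ ^ r ∂μ ≤ C n * ∫⁻ x, ‖g x‖ₑ ^ r ∂μ) :
    Tendsto (fun n => ∫⁻ x, ‖f n x - g x‖ₑ ^ r ∂μ) atTop (𝓝 0) := by
  have hr0 : 0 < r := by linarith
  set I := ∫⁻ x, ‖g x‖ₑ ^ r ∂μ with hIdef
  let B : ENNReal := 2 ^ (r - 1)
  have hB : B ≠ ⊤ := ENNReal.rpow_ne_top_of_nonneg (by linarith) (by simp)
  let c : ℕ → α → ENNReal := fun n x => ‖f n x - g x‖ₑ ^ r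
  let s : ℕ → α → ENNReal := fun n x => B * (‖f n x‖ₑ ^ r + ‖g x‖ₑ ^ r)
  have hcs : ∀ n x, c n x ≤ s n x := by
    intro n x
    refine le_trans ?_ (ENNReal.rpow_add_le_mul_rpow_add_rpow _ _ hr)
    exact ENNReal.rpow_le_rpow (enorm_sub_le) hr0.le
  have hcm : ∀ n, Measurable (c n) := fun n => ((hf n).sub hg).enorm.pow_const r
  have hsm : ∀ n, Measurable (s n) := fun n =>
    ((((hf n).enorm.pow_const r).add (hg.enorm.pow_const r)).const_mul B)
  have hgm : ∀ n, Measurable (fun x => s n x - c n x) := fun n => (hsm n).sub (hcm n)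
  have hfat := lintegral_liminf_le (μ := μ) (u := atTop) hgm
  have hT : ∫⁻ a, liminf (fun n => s n a - c n a) atTop ∂μ = B * (I + I) := by
    have : ∀ᵐ a ∂μ, liminf (fun n => s n a - c n a) atTop = B * (‖g a‖ₑ ^ r + ‖g a‖ₑ ^ r) := by
      filter_upwards [hlim] with a ha
      apply Tendsto.liminf_eq
      have h1 : Tendsto (fun n => ‖f n a‖ₑ ^ r) atTop (𝓝 (‖g a‖ₑ ^ r)) :=
        (ENNReal.continuous_rpow_const.tendsto _).comp ha.enorm
      have h2 : Tendsto (fun n => s n a) atTop (𝓝 (B * (‖g a‖ₑ ^ r + ‖g a‖ₑ ^ r))) :=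
        ENNReal.Tendsto.const_mul (h1.add tendsto_const_nhds) (Or.inr hB)
      have h3 : Tendsto (fun n => c n a) atTop (𝓝 0) := by
        have h4 : Tendsto (fun n => f n a - g a) atTop (𝓝 0) := by
          simpa using ha.sub_const (g a)
        have := (ENNReal.continuous_rpow_const (y := r)).tendsto _ |>.comp h4.enorm
        simpa [c, hr0, Function.comp_def] using this
      have := ENNReal.Tendsto.sub h2 h3 (Or.inr (by simp))
      simpa using this
    rw [lintegral_congr_ae this, lintegral_const_mul' _ _ hB, lintegral_add_left (hg.enorm.pow_const r)]
  rw [hT] at hfat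
  have hTtop : B * (I + I) ≠ ⊤ := ENNReal.mul_ne_top hB (by simp [hI])
  let U : ℕ → ENNReal := fun n => B * (C n * I + I)
  have hU : Tendsto U atTop (𝓝 (B * (I + I))) := by
    have : Tendsto (fun n => C n * I) atTop (𝓝 (1 * I)) :=
      ENNReal.Tendsto.mul_const hC (Or.inr hI)
    rw [one_mul] at this
    exact ENNReal.Tendsto.const_mul (this.add tendsto_const_nhds) (Or.inr hB)
  have hDE : ∀ n, ∫⁻ x, c n x ∂μ + ∫⁻ x, (s n x - c n x) ∂μ ≤ U n := by
    intro n
    rw [← lintegral_add_left (hcm n)]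
    calc _ = ∫⁻ x, s n x ∂μ := lintegral_congr fun x => add_tsub_cancel_of_le (hcs n x)
      _ = B * (∫⁻ x, ‖f n x‖ₑ ^ r ∂μ + I) := by
        rw [lintegral_const_mul' _ _ hB, lintegral_add_left ((hf n).enorm.pow_const r)]
      _ ≤ _ := mul_le_mul_right (add_le_add_left (hle n) _) _
  have hE : Tendsto (fun n => ∫⁻ x, (s n x - c n x) ∂μ) atTop (𝓝 (B * (I + I))) := by
    apply tendsto_of_le_liminf_of_limsup_le hfat
    rw [← hU.limsup_eq]
    exact limsup_le_limsup (Eventually.of_forall fun n => le_add_self.trans (hDE n))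
  have hfin : ∀ᶠ n in atTop, ∫⁻ x, (s n x - c n x) ∂μ ≠ ⊤ :=
    (hE.eventually_lt_const hTtop.lt_top).mono fun n h => h.ne
  have h0 := ENNReal.Tendsto.sub hU hE (Or.inl hTtop)
  rw [tsub_self] at h0
  refine tendsto_of_tendsto_of_tendsto_of_le_of_le' tendsto_const_nhds h0
    (Eventually.of_forall fun n => zero_le) ?_
  filter_upwards [hfin] with n hn
  exact ENNReal.le_sub_of_add_le_right hn (hDE n)

/-- representative in the fundamental domain -/
noncomputable def rep {d : ℕ} (x : Phase d) : Phase d :=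
  (fun i => 2 * Real.pi * Int.fract (x.1 i / (2 * Real.pi)), x.2)

theorem rep_measurable {d : ℕ} : Measurable (rep : Phase d → Phase d) := by
  refine Measurable.prodMk (measurable_pi_lambda _ fun i => ?_) measurable_snd
  exact (((measurable_pi_apply i).comp measurable_fst).div_const _).fract.const_mul _

theorem rep_tsh {d : ℕ} (k : Fin d → ℤ) (x : Phase d) : rep (tsh k x) = rep x := by
  have : 2 * Real.pi ≠ 0 := by positivity
  ext i
  · simp only [rep, tsh, sh]
    congr 1
    rw [add_div, mul_div_cancel_left₀ _ this, Int.fract_add_intCast]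
  · rfl

theorem rep_eq {d : ℕ} (x : Phase d) (hx : x ∈ torusBlock d) : rep x = x := by
  have : 0 < 2 * Real.pi := by positivity
  ext i
  · simp only [rep]
    rw [Int.fract_eq_self.2, mul_div_cancel₀ _ this.ne']
    have := hx i
    constructor
    · exact div_nonneg this.1 (by positivity)
    · rw [div_lt_one (by positivity)]; exact this.2
  · rfl

/-- the walls -/
def walls (d : ℕ) : Set (Phase d) := {x | ∃ i, ∃ m : ℤ, x.1 i = 2 * Real.pi * m}

theorem rep_continuousAt {d : ℕ} (x : Phase d) (hx : x ∉ walls d) : ContinuousAt rep x := by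
  have hpi : 2 * Real.pi ≠ 0 := by positivity
  refine ContinuousAt.prodMk (continuousAt_pi.2 fun i => ?_) continuousAt_snd
  have h1 : ContinuousAt (fun x : Phase d => x.1 i / (2 * Real.pi)) x := by fun_prop
  have h2 : ContinuousAt (Int.fract : ℝ → ℝ) (x.1 i / (2 * Real.pi)) := by
    refine (continuousOn_fract ⌊x.1 i / (2 * Real.pi)⌋).continuousAt (Ico_mem_nhds ?_ (Int.lt_floor_add_one _))
    refine lt_of_le_of_ne (Int.floor_le _) fun h => hx ⟨i, ⌊x.1 i / (2 * Real.pi)⌋, ?_⟩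
    rw [h]; field_simp
  exact (ContinuousAt.comp (f := fun x : Phase d => x.1 i / (2 * Real.pi)) h2 h1).const_mul _

theorem coord_null {d : ℕ} (i : Fin d) (c : ℝ) : volume {x : Phase d | x.1 i = c} = 0 := by
  have h1 : (volume : Measure (Fin d → ℝ)) {f | f i = c} = 0 := by
    have := Measure.pi_hyperplane (fun _ : Fin d => (volume : Measure ℝ)) i c
    exact this
  exact (Measure.quasiMeasurePreserving_fst (μ := (volume : Measure (Fin d → ℝ)))
    (ν := (volume : Measure (Fin d → ℝ)))).preimage_null h1

theorem walls_eq (d : ℕ) : walls d = ⋃ i, ⋃ m : ℤ, {x : Phase d | x.1 i = 2 * Real.pi * m} := by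
  ext x; simp [walls]

theorem walls_null (d : ℕ) : volume (walls d) = 0 := by
  rw [walls_eq]
  exact measure_iUnion_null fun i => measure_iUnion_null fun m => coord_null i _

theorem walls_meas (d : ℕ) : MeasurableSet (walls d) := by
  rw [walls_eq]
  refine MeasurableSet.iUnion fun i => MeasurableSet.iUnion fun m => ?_
  exact measurableSet_eq_fun ((measurable_pi_apply i).comp measurable_fst) measurable_const

theorem walls_tsh {d : ℕ} (k : Fin d → ℤ) (x : Phase d) : tsh k x ∈ walls d ↔ x ∈ walls d := by
  constructor
  · rintro ⟨i, m, h⟩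
    refine ⟨i, m - k i, ?_⟩
    simp only [tsh, sh] at h
    push_cast; linarith
  · rintro ⟨i, m, h⟩
    refine ⟨i, m + k i, ?_⟩
    simp only [tsh, sh]
    push_cast; linarith

theorem Good.ae_notMem {d : ℕ} {C : ENNReal} {G : Phase d → Phase d} (hG : Good C G)
    (N : Set (Phase d)) (hm : MeasurableSet N) (hn : volume N = 0)
    (hp : ∀ k x, tsh k x ∈ N ↔ x ∈ N) :
    ∀ᵐ x ∂(volume.restrict (torusBlock d)), G x ∉ N := by
  classical
  have h := hG.bd (N.indicator 1) (measurable_one.indicator hm) (fun k x => by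
    simp [Set.indicator_apply, hp])
  have h0 : ∫⁻ x in torusBlock d, N.indicator (1 : Phase d → ENNReal) x = 0 := by
    rw [lintegral_indicator_one hm]
    exact le_antisymm ((Measure.restrict_apply_le _ _).trans hn.le) zero_le
  rw [h0, mul_zero] at h
  have h2 := (lintegral_eq_zero_iff ((measurable_one.indicator hm).comp hG.meas)).1
    (le_antisymm h zero_le)
  filter_upwards [h2] with x hx hxN
  simp [hxN] at hx

theorem Good.eLpNorm_le {d : ℕ} {C : ENNReal} {G : Phase d → Phase d} (hG : Good C G)
    (r : ℝ) (hr : 1 ≤ r) (f : Phase d → ℝ) (hf : Measurable f) (hp : ∀ k x, f (tsh k x) = f x) :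
    eLpNorm (fun x => f (G x)) (ENNReal.ofReal r) (volume.restrict (torusBlock d)) ≤
      C ^ (1 / r) * eLpNorm f (ENNReal.ofReal r) (volume.restrict (torusBlock d)) := by
  have h0 : ENNReal.ofReal r ≠ 0 := by simp; linarith
  rw [eLpNorm_eq_lintegral_rpow_enorm_toReal h0 (by simp),
    eLpNorm_eq_lintegral_rpow_enorm_toReal h0 (by simp), ENNReal.toReal_ofReal (by linarith)]
  rw [← ENNReal.mul_rpow_of_nonneg _ _ (by positivity)]
  refine ENNReal.rpow_le_rpow ?_ (by positivity)
  exact hG.bd (fun x => ‖f x‖ₑ ^ r) (hf.enorm.pow_const r) (fun k x => by rw [hp])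

instance phase_locfin {d : ℕ} : IsLocallyFiniteMeasure (volume : Measure (Phase d)) :=
  isLocallyFiniteMeasure_of_isFiniteMeasureOnCompacts

instance phase_regular {d : ℕ} : (volume : Measure (Phase d)).Regular :=
  Measure.Regular.of_sigmaCompactSpace_of_isLocallyFiniteMeasure _

open Filter Topology in
theorem limit_lemma {d : ℕ} (r : ℝ) (hr : 1 ≤ r) (C : ℕ → ENNReal) (Gn : ℕ → Phase d → Phase d)
    (G : Phase d → Phase d) (hGn : ∀ n, Good (C n) (Gn n)) (hC : Tendsto C atTop (𝓝 1))
    (hG : Exact G)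
    (hlim : ∀ᵐ x ∂(volume.restrict (torusBlock d)), Tendsto (fun n => Gn n x) atTop (𝓝 (G x)))
    (ρ : Phase d → ℝ) (hρ : IsTorusDensity (ENNReal.ofReal r) ρ) :
    Tendsto (fun n => eLpNorm (fun x => ρ (Gn n x) - ρ (G x)) (ENNReal.ofReal r)
      (volume.restrict (torusBlock d))) atTop (𝓝 0) := by
  obtain ⟨hρm, hρp, hρt⟩ := hρ
  replace hρp : ∀ k x, ρ (tsh k x) = ρ x := fun k x => hρp x.1 x.2 k
  have hQ := measurableSet_torusBlock d
  have hr0 : ENNReal.ofReal r ≠ 0 := by simp; linarith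
  have hr1 : (1 : ENNReal) ≤ ENNReal.ofReal r := by simpa using hr
  rw [ENNReal.tendsto_nhds_zero]
  intro ε0 hε0
  let ε := min ε0 1
  have hε : 0 < ε := lt_min hε0 one_pos
  have hεt : ε ≠ ⊤ := ((min_le_right _ _).trans_lt (by simp)).ne
  have hmem : MemLp ((torusBlock d).indicator ρ) (ENNReal.ofReal r) volume :=
    (memLp_indicator_iff_restrict hQ).2 ⟨hρm.aestronglyMeasurable, hρt⟩
  obtain ⟨η0, -, hη0, hηc, hηm⟩ := hmem.exists_hasCompactSupport_eLpNorm_sub_le (by simp)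
    (ε := ε / 8) (by simp [hε.ne'])
  let η : Phase d → ℝ := fun x => η0 (rep x)
  have hηmeas : Measurable η := hηc.measurable.comp rep_measurable
  have hηp : ∀ k x, η (tsh k x) = η x := fun k x => by simp [η, rep_tsh]
  have hdiff : eLpNorm (ρ - η) (ENNReal.ofReal r) (volume.restrict (torusBlock d)) ≤ ε / 8 := by
    refine le_trans (le_of_eq ?_) ((eLpNorm_mono_measure _ (Measure.restrict_le_self (s := torusBlock d))).trans hη0)
    apply eLpNorm_congr_ae
    filter_upwards [ae_restrict_mem hQ] with x hx
    simp [η, rep_eq x hx, hx]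
  have hηI : ∫⁻ x in torusBlock d, ‖η x‖ₑ ^ r ≠ ⊤ := by
    have h1 : ∫⁻ x in torusBlock d, ‖η x‖ₑ ^ r = ∫⁻ x in torusBlock d, ‖η0 x‖ₑ ^ r := by
      apply lintegral_congr_ae
      filter_upwards [ae_restrict_mem hQ] with x hx
      simp [η, rep_eq x hx]
    rw [h1]
    have h2 := lintegral_rpow_enorm_lt_top_of_eLpNorm_lt_top hr0 (by simp) hηm.2
    rw [ENNReal.toReal_ofReal (by linarith)] at h2
    exact ((setLIntegral_le_lintegral _ _).trans_lt h2).ne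
  have hmid0 : Tendsto (fun n => ∫⁻ x in torusBlock d, ‖η (Gn n x) - η (G x)‖ₑ ^ r) atTop (𝓝 0) := by
    have hle1 := hG.good.bd (fun x => ‖η x‖ₑ ^ r) (hηmeas.enorm.pow_const r) (fun k x => by rw [hηp])
    have hle2 := hG.ge (fun x => ‖η x‖ₑ ^ r) (hηmeas.enorm.pow_const r) (fun k x => by rw [hηp])
    rw [one_mul] at hle1
    refine pratt _ r hr (fun n x => η (Gn n x)) (fun x => η (G x))
      (fun n => hηmeas.comp (hGn n).meas) (hηmeas.comp hG.good.meas) ?_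
      (ne_top_of_le_ne_top hηI hle1) C hC fun n => ?_
    · filter_upwards [hlim, hG.good.ae_notMem (walls d) (walls_meas d) (walls_null d) walls_tsh]
        with x hx hxw
      exact (ContinuousAt.comp (f := rep) hηc.continuousAt (rep_continuousAt _ hxw)).tendsto.comp hx
    · refine ((hGn n).bd (fun x => ‖η x‖ₑ ^ r) (hηmeas.enorm.pow_const r)
        (fun k x => by rw [hηp])).trans ?_
      exact mul_le_mul_right hle2 _
  have hmid : Tendsto (fun n => eLpNorm (fun x => η (Gn n x) - η (G x)) (ENNReal.ofReal r)
      (volume.restrict (torusBlock d))) atTop (𝓝 0) := by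
    simp only [eLpNorm_eq_lintegral_rpow_enorm_toReal hr0 ENNReal.ofReal_ne_top,
      ENNReal.toReal_ofReal (by linarith : (0:ℝ) ≤ r)]
    have := ((ENNReal.continuous_rpow_const (y := 1 / r)).tendsto 0).comp hmid0
    rwa [ENNReal.zero_rpow_of_pos (by positivity)] at this
  have hC2 : ∀ᶠ n in atTop, C n ≤ 2 := hC.eventually_le_const (by norm_num)
  filter_upwards [hC2, (ENNReal.tendsto_nhds_zero.1 hmid) (ε / 8) (by simp [hε.ne'])] with n h2 h3
  have hd := hρm.sub hηmeas
  have hdp : ∀ k x, (ρ - η) (tsh k x) = (ρ - η) x := fun k x => by simp [hρp, hηp]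
  have e1 := (hGn n).eLpNorm_le r hr (ρ - η) hd hdp
  have e2 := hG.good.eLpNorm_le r hr (ρ - η) hd hdp
  have hCr : C n ^ (1 / r) ≤ 2 := by
    calc C n ^ (1 / r) ≤ 2 ^ (1 / r) := ENNReal.rpow_le_rpow h2 (by positivity)
      _ ≤ 2 ^ (1 : ℝ) := ENNReal.rpow_le_rpow_of_exponent_le (by norm_num)
          (by rw [div_le_one (by linarith)]; exact hr)
      _ = 2 := by simp
  have hsplit : (fun x => ρ (Gn n x) - ρ (G x)) =
      (fun x => (ρ - η) (Gn n x)) + ((fun x => η (Gn n x) - η (G x)) - (fun x => (ρ - η) (G x))) := by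
    funext x; simp
  rw [hsplit]
  have m1 := (hd.comp (hGn n).meas).aestronglyMeasurable (μ := volume.restrict (torusBlock d))
  have m2 := (hd.comp hG.good.meas).aestronglyMeasurable (μ := volume.restrict (torusBlock d))
  have m3 := ((hηmeas.comp (hGn n).meas).sub (hηmeas.comp hG.good.meas)).aestronglyMeasurable
    (μ := volume.restrict (torusBlock d))
  refine (eLpNorm_add_le m1 (m3.sub m2) hr1).trans ?_
  have h5 := eLpNorm_sub_le m3 m2 hr1
  calc _ ≤ 2 * (ε / 8) + (ε / 8 + 1 * (ε / 8)) := by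
        refine add_le_add (e1.trans (mul_le_mul' hCr hdiff)) (h5.trans (add_le_add h3 (e2.trans ?_)))
        rw [ENNReal.one_rpow]
        exact mul_le_mul_right hdiff _
    _ ≤ 8 * (ε / 8) := by
        have : 2 * (ε / 8) + (ε / 8 + 1 * (ε / 8)) = 4 * (ε / 8) := by ring
        rw [this]
        gcongr
        norm_num
    _ = ε := ENNReal.mul_div_cancel (by norm_num) (by norm_num)
    _ ≤ ε0 := min_le_left _ _

open MeasureTheory Real

theorem periodic_bounded {d : ℕ} {E : Type*} [NormedAddCommGroup E] (f : (Fin d → ℝ) → E)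
    (hf : Continuous f) (hp : ∀ k q, f (sh k q) = f q) : ∃ C : NNReal, ∀ q, ‖f q‖ ≤ C := by
  obtain ⟨C, hC⟩ := (isCompact_Icc (a := (0 : Fin d → ℝ)) (b := fun _ => 2 * Real.pi)).exists_bound_of_continuousOn
    hf.continuousOn
  refine ⟨C.toNNReal, fun q => ?_⟩
  obtain ⟨k, hk⟩ := exists_shift ((q, 0) : Phase d)
  rw [← hp k q]
  refine (hC _ ⟨fun i => (hk i).1, fun i => (hk i).2.le⟩).trans (Real.le_coe_toNNReal C)

theorem periodic_lip {d : ℕ} {E : Type*} [NormedAddCommGroup E] [NormedSpace ℝ E]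
    (f : (Fin d → ℝ) → E)
    (hf : ContDiff ℝ 1 f) (hp : ∀ k q, f (sh k q) = f q) : ∃ K : NNReal, LipschitzWith K f := by
  have h1 : ∀ k q, fderiv ℝ f (sh k q) = fderiv ℝ f q := by
    intro k q
    have : (fun q => f (q + fun i => 2 * Real.pi * (k i : ℝ))) = f := by
      funext q; exact hp k q
    rw [sh_eq, ← fderiv_comp_add_right, this]
  obtain ⟨K, hK⟩ := periodic_bounded (fderiv ℝ f) (hf.continuous_fderiv one_ne_zero) h1
  exact ⟨K, lipschitzWith_of_nnnorm_fderiv_le (hf.differentiable (by norm_num)) fun q => by exact_mod_cast hK q⟩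

/-- integer frequencies -/
def kvecZ (d : ℕ) (j : Fin d) : Fin d → ℤ :=
  if (j : ℕ) < d - 1 then Pi.single j 1 else fun _ => 1

theorem kvec_cast (d : ℕ) (j i : Fin d) : kvec d j i = (kvecZ d j i : ℝ) := by
  unfold kvec kvecZ
  split_ifs
  · by_cases h : i = j
    · subst h; simp
    · simp [h]
  · simp

/-- pairing of an integer frequency with a position -/
def dotZ {d : ℕ} (k : Fin d → ℤ) (q : Fin d → ℝ) : ℝ := ∑ i, (k i : ℝ) * q i

/-- real vector of an integer frequency -/
def vecZ {d : ℕ} (k : Fin d → ℤ) : Fin d → ℝ := fun i => (k i : ℝ)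

theorem dotZ_sh {d : ℕ} (k m : Fin d → ℤ) (q : Fin d → ℝ) :
    dotZ k (sh m q) = dotZ k q + (∑ i, k i * m i : ℤ) * (2 * Real.pi) := by
  unfold dotZ sh
  push_cast
  rw [Finset.sum_mul, ← Finset.sum_add_distrib]
  exact Finset.sum_congr rfl fun i _ => by ring

theorem dotZ_contDiff {d : ℕ} (k : Fin d → ℤ) : ContDiff ℝ (⊤ : ℕ∞) (dotZ k) := by
  unfold dotZ
  exact ContDiff.sum fun i _ => contDiff_const.mul (contDiff_apply ℝ ℝ i)

/-- drift acceleration -/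
noncomputable def a0 {d : ℕ} (V0 : (Fin d → ℝ) → ℝ) (q : Fin d → ℝ) : Fin d → ℝ :=
  fun i => -(fderiv ℝ V0 q (Pi.single i 1))

/-- control acceleration -/
noncomputable def wF {d : ℕ} (u : Fin d → ℝ × ℝ) (q : Fin d → ℝ) : Fin d → ℝ :=
  fun i => ∑ j, ((u j).1 * sin (dotZ (kvecZ d j) q) - (u j).2 * cos (dotZ (kvecZ d j) q)) * kvec d j i

theorem wF_contDiff {d : ℕ} (u : Fin d → ℝ × ℝ) : ContDiff ℝ 1 (wF u) := by
  refine contDiff_pi.2 fun i => ContDiff.sum fun j _ => ?_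
  have := (dotZ_contDiff (kvecZ d j)).of_le (m := 1) (by exact_mod_cast le_top)
  exact ((contDiff_const.mul this.sin).sub (contDiff_const.mul this.cos)).mul contDiff_const

theorem wF_per {d : ℕ} (u : Fin d → ℝ × ℝ) (k : Fin d → ℤ) (q : Fin d → ℝ) :
    wF u (sh k q) = wF u q := by
  funext i
  simp only [wF, dotZ_sh, Real.sin_add_int_mul_two_pi, Real.cos_add_int_mul_two_pi]

theorem a0_contDiff {d : ℕ} (V0 : (Fin d → ℝ) → ℝ) (hV0 : ContDiff ℝ (⊤ : ℕ∞) V0) :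
    ContDiff ℝ 1 (a0 V0) := by
  refine contDiff_pi.2 fun i => ?_
  have h : ContDiff ℝ 1 (fderiv ℝ V0) := hV0.fderiv_right (m := 1) (by
    have : ((1 : WithTop ℕ∞) + 1) = ((2 : ℕ∞) : WithTop ℕ∞) := by norm_num
    rw [this]; exact_mod_cast (le_top : (2 : ℕ∞) ≤ ⊤))
  exact (h.clm_apply contDiff_const).neg

theorem a0_per {d : ℕ} (V0 : (Fin d → ℝ) → ℝ)
    (hper : ∀ (q : Fin d → ℝ) (k : Fin d → ℤ), V0 (fun i => q i + 2 * Real.pi * (k i)) = V0 q)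
    (k : Fin d → ℤ) (q : Fin d → ℝ) : a0 V0 (sh k q) = a0 V0 q := by
  have : (fun q => V0 (q + fun i => 2 * Real.pi * (k i : ℝ))) = V0 := by
    funext q; exact hper q k
  funext i
  rw [a0, a0, sh_eq, ← fderiv_comp_add_right, this]

theorem hamVF_eq {d : ℕ} (V0 : (Fin d → ℝ) → ℝ) (hV0 : ContDiff ℝ (⊤ : ℕ∞) V0)
    (u : Fin d → ℝ × ℝ) : hamVF (torusHam V0 u) = fld (fun q => a0 V0 q + wF u q) := by
  funext x
  let P : Fin d → Phase d →L[ℝ] ℝ := fun i =>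
    (ContinuousLinearMap.proj i).comp (ContinuousLinearMap.snd ℝ (Fin d → ℝ) (Fin d → ℝ))
  let Q : Fin d → Phase d →L[ℝ] ℝ := fun i =>
    (ContinuousLinearMap.proj i).comp (ContinuousLinearMap.fst ℝ (Fin d → ℝ) (Fin d → ℝ))
  let S : Fin d → Phase d →L[ℝ] ℝ := fun j => ∑ i, kvec d j i • Q i
  have hP : ∀ i, HasFDerivAt (fun x : Phase d => x.2 i) (P i) x := fun i => (P i).hasFDerivAt
  have hS : ∀ j, HasFDerivAt (fun x : Phase d => ∑ i, kvec d j i * x.1 i) (S j) x := by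
    intro j
    have := (S j).hasFDerivAt (x := x)
    convert! this using 1
    funext y
    simp [S, Q]
  have h1 : HasFDerivAt (fun x : Phase d => ∑ i, (x.2 i) ^ 2) (∑ i, (2 * x.2 i) • P i) x := by
    refine HasFDerivAt.fun_sum fun i _ => ?_
    have := (hP i).pow 2
    simpa using this
  have h2 : HasFDerivAt (fun x : Phase d => V0 x.1)
      ((fderiv ℝ V0 x.1).comp (ContinuousLinearMap.fst ℝ (Fin d → ℝ) (Fin d → ℝ))) x :=
    ((hV0.differentiable (by simp)).differentiableAt.hasFDerivAt (x := x.1)).comp x hasFDerivAt_fst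
  have h3 : HasFDerivAt (fun x : Phase d => ∑ j, ((u j).1 * Real.cos (∑ i, kvec d j i * x.1 i) +
          (u j).2 * Real.sin (∑ i, kvec d j i * x.1 i)))
      (∑ j, ((u j).1 • (-sin (∑ i, kvec d j i * x.1 i) • S j) +
        (u j).2 • (cos (∑ i, kvec d j i * x.1 i) • S j))) x :=
    HasFDerivAt.fun_sum fun j _ => ((hS j).cos.const_mul _).add ((hS j).sin.const_mul _)
  have h4 : HasFDerivAt (torusHam V0 u) _ x := ((h1.mul_const (2⁻¹ : ℝ)).add h2).add h3
  have hSs : ∀ j i, S j (Pi.single i 1, 0) = kvec d j i := by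
    intro j i
    simp [S, Q, Pi.single_apply]
  have hSt : ∀ j i, S j (0, Pi.single i 1) = 0 := by
    intro j i
    simp [S, Q]
  have hd : ∀ j, (∑ i, kvec d j i * x.1 i) = dotZ (kvecZ d j) x.1 := by
    intro j; simp [dotZ, kvec_cast]
  unfold hamVF
  rw [h4.fderiv]
  simp only [hd]
  ext i
  · simp [fld, hSt, P, Pi.single_apply]
  · simp only [fld, Pi.add_apply, a0, wF]
    simp [hSs, P]
    rw [← Finset.sum_neg_distrib, add_comm]
    congr 1
    exact Finset.sum_congr rfl fun j _ => by ring

open MeasureTheory Real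

theorem flow_est {d : ℕ} {a : (Fin d → ℝ) → (Fin d → ℝ)} {φ : ℝ → Phase d → Phase d}
    (hφ : IsFlowOf (fld a) φ) (C : ℝ) (hC : ∀ q, ‖a q‖ ≤ C) (x : Phase d) (t : ℝ) (ht : 0 ≤ t) :
    ‖(φ t x).2 - x.2‖ ≤ C * t ∧ ‖(φ t x).1 - x.1‖ ≤ (‖x.2‖ + C * t) * t ∧
      ‖(φ t x).1 - x.1 - t • x.2‖ ≤ C * t * t := by
  have hC0 : 0 ≤ C := (norm_nonneg _).trans (hC 0)
  have d1 : ∀ s, HasDerivAt (fun s => (φ s x).1) (φ s x).2 s := fun s => (hφ.2 x s).fst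
  have d2 : ∀ s, HasDerivAt (fun s => (φ s x).2) (a (φ s x).1) s := fun s => (hφ.2 x s).snd
  have e1 : ∀ s ∈ Set.Icc 0 t, ‖(φ s x).2 - x.2‖ ≤ C * s := by
    intro s hs
    have := norm_image_sub_le_of_norm_deriv_le_segment' (f := fun s => (φ s x).2) (a := 0) (b := s)
      (f' := fun s => a (φ s x).1) (C := C) (fun s _ => (d2 s).hasDerivWithinAt)
      (fun s _ => hC _) s ⟨hs.1, le_rfl⟩
    simpa [hφ.1] using this
  have e2 : ∀ s ∈ Set.Ico 0 t, ‖(φ s x).2 - x.2‖ ≤ C * t := fun s hs =>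
    (e1 s ⟨hs.1, hs.2.le⟩).trans (mul_le_mul_of_nonneg_left hs.2.le hC0)
  refine ⟨e1 t ⟨ht, le_rfl⟩, ?_, ?_⟩
  · have := norm_image_sub_le_of_norm_deriv_le_segment' (f := fun s => (φ s x).1) (a := 0) (b := t)
      (f' := fun s => (φ s x).2) (C := ‖x.2‖ + C * t) (fun s _ => (d1 s).hasDerivWithinAt)
      (fun s hs => by
        have h1 := e2 s hs
        have h2 : (φ s x).2 = x.2 + ((φ s x).2 - x.2) := by abel
        rw [h2]
        exact (norm_add_le _ _).trans (add_le_add_right h1 _)) t ⟨ht, le_rfl⟩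
    simpa [hφ.1] using this
  · have := norm_image_sub_le_of_norm_deriv_le_segment' (f := fun s => (φ s x).1 - s • x.2) (a := 0) (b := t)
      (f' := fun s => (φ s x).2 - x.2) (C := C * t) (fun s _ => by
        have := (d1 s).sub ((hasDerivAt_id s).smul_const x.2)
        simp only [id, one_smul] at this
        exact this.hasDerivWithinAt)
      (fun s hs => e2 s hs) t ⟨ht, le_rfl⟩
    simp only [hφ.1, zero_smul, sub_zero] at this
    rwa [sub_right_comm] at this

theorem flow_est2 {d : ℕ} {a : (Fin d → ℝ) → (Fin d → ℝ)} {φ : ℝ → Phase d → Phase d}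
    (hφ : IsFlowOf (fld a) φ) (C : ℝ) (hC : ∀ q, ‖a q‖ ≤ C) {K : NNReal} (ha : LipschitzWith K a)
    (x : Phase d) (t : ℝ) (ht : 0 ≤ t) :
    ‖(φ t x).2 - x.2 - t • a x.1‖ ≤ K * ((‖x.2‖ + C * t) * t) * t := by
  have hC0 : 0 ≤ C := (norm_nonneg _).trans (hC 0)
  have d2 : ∀ s, HasDerivAt (fun s => (φ s x).2) (a (φ s x).1) s := fun s => (hφ.2 x s).snd
  have := norm_image_sub_le_of_norm_deriv_le_segment' (f := fun s => (φ s x).2 - s • a x.1)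
    (a := 0) (b := t)
    (f' := fun s => a (φ s x).1 - a x.1) (C := K * ((‖x.2‖ + C * t) * t)) (fun s _ => by
      have := (d2 s).sub ((hasDerivAt_id s).smul_const (a x.1))
      simp only [id, one_smul] at this
      exact this.hasDerivWithinAt)
    (fun s hs => by
      have h1 := (flow_est hφ C hC x s hs.1).2.1
      rw [← dist_eq_norm]
      refine (ha.dist_le_mul _ _).trans (mul_le_mul_of_nonneg_left ?_ K.2)
      rw [dist_eq_norm]
      refine h1.trans ?_
      have := hs.2.le
      have := hs.1
      gcongr) t ⟨ht, le_rfl⟩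
  simp only [hφ.1, zero_smul, sub_zero] at this
  rwa [sub_right_comm] at this

/-- density reachability of `G` in time `T` -/
def DR {d : ℕ} (V0 : (Fin d → ℝ) → ℝ) (r T : ℝ) (G : Phase d → Phase d) : Prop :=
  ∀ ρ, IsTorusDensity (ENNReal.ofReal r) ρ → ∀ ε > (0:ℝ), ∃ τ, 0 ≤ τ ∧ τ ≤ T + ε ∧
    ∃ Φ : Phase d → Phase d, Reachable (torusHam V0) τ Φ ∧
      eLpNorm (fun x => ρ (Φ x) - ρ (G x)) (ENNReal.ofReal r)
          (volume.restrict (torusBlock d)) < ENNReal.ofReal ε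

/-- standing hypotheses -/
structure Setup {d : ℕ} (V0 : (Fin d → ℝ) → ℝ) (r : ℝ) : Prop where
  hV0 : ContDiff ℝ (⊤ : ℕ∞) V0
  hper : ∀ (q : Fin d → ℝ) (k : Fin d → ℤ), V0 (fun i => q i + 2 * Real.pi * (k i)) = V0 q
  hr : 1 ≤ r

theorem foldl_comp_append {α : Type*} (l : List (α → α)) (g : α → α) :
    l.foldl (fun g f => f ∘ g) g = l.foldl (fun g f => f ∘ g) id ∘ g := by
  induction l generalizing g with
  | nil => rfl
  | cons a l ih =>
    simp only [List.foldl_cons]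
    rw [ih, ih (a ∘ id)]
    rfl

theorem foldl_good {d : ℕ} (l : List (Phase d → Phase d))
    (h : ∀ f ∈ l, ∃ C : ENNReal, C ≠ ⊤ ∧ Good C f) :
    ∃ C : ENNReal, C ≠ ⊤ ∧ Good C (l.foldl (fun g f => f ∘ g) id) := by
  induction l with
  | nil => exact ⟨1, by simp, good_id⟩
  | cons a l ih =>
    obtain ⟨C, hC, hg⟩ := ih (fun f hf => h f (List.mem_cons_of_mem _ hf))
    obtain ⟨D, hD, hga⟩ := h a List.mem_cons_self
    refine ⟨C * D, ENNReal.mul_ne_top hC hD, ?_⟩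
    simp only [List.foldl_cons]
    rw [foldl_comp_append]
    exact hg.comp hga

theorem Setup.field {d : ℕ} {V0 : (Fin d → ℝ) → ℝ} {r : ℝ} (S : Setup V0 r) :
    ∃ C K : NNReal, (∀ q, ‖a0 V0 q‖ ≤ C) ∧ LipschitzWith K (a0 V0) := by
  have h1 := a0_contDiff V0 S.hV0
  have h2 := a0_per V0 S.hper
  obtain ⟨C, hC⟩ := periodic_bounded _ h1.continuous h2
  obtain ⟨K, hK⟩ := periodic_lip _ h1 h2
  exact ⟨C, K, hC, hK⟩

theorem Reachable.good {d : ℕ} {V0 : (Fin d → ℝ) → ℝ} {r : ℝ} (S : Setup V0 r) {τ : ℝ}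
    {Φ : Phase d → Phase d} (h : Reachable (torusHam V0) τ Φ) : ∃ C : ENNReal, C ≠ ⊤ ∧ Good C Φ := by
  obtain ⟨n, dur, u, φ, h0, -, hφ, rfl⟩ := h
  apply foldl_good
  intro f hf
  rw [List.mem_ofFn] at hf
  obtain ⟨i, rfl⟩ := hf
  have hi := hφ i
  rw [hamVF_eq V0 S.hV0] at hi
  have hper : ∀ k q, (a0 V0 (sh k q) + wF (u i) (sh k q)) = a0 V0 q + wF (u i) q := fun k q => by
    rw [a0_per V0 S.hper, wF_per]
  obtain ⟨K, hK⟩ := periodic_lip (fun q => a0 V0 q + wF (u i) q)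
    ((a0_contDiff V0 S.hV0).add (wF_contDiff _)) hper
  exact ⟨_, by finiteness, flow_good hK hi (fun q k => hper k q) 1 one_pos (max 1 K) (by simp) (by simp)
    (dur i) (h0 i)⟩

theorem Reachable.comp {d : ℕ} {V0 : (Fin d → ℝ) → ℝ} {τ τ' : ℝ}
    {Φ Ψ : Phase d → Phase d} (h : Reachable (torusHam V0) τ Φ) (h' : Reachable (torusHam V0) τ' Ψ) :
    Reachable (torusHam V0) (τ + τ') (Φ ∘ Ψ) := by
  obtain ⟨n, dur, u, φ, h0, hs, hφ, rfl⟩ := h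
  obtain ⟨m, dur', u', φ', h0', hs', hφ', rfl⟩ := h'
  refine ⟨m + n, Fin.append dur' dur, Fin.append u' u, Fin.append φ' φ, ?_, ?_, ?_, ?_⟩
  · intro i
    refine Fin.addCases (fun i => ?_) (fun i => ?_) i
    · simpa using h0' i
    · simpa using h0 i
  · rw [Fin.sum_univ_add]
    simp [hs, hs', add_comm]
  · intro i
    refine Fin.addCases (fun i => ?_) (fun i => ?_) i
    · simpa using hφ' i
    · simpa using hφ i
  · have : (fun i => Fin.append φ' φ i (Fin.append dur' dur i)) =
        Fin.append (fun i => φ' i (dur' i)) (fun i => φ i (dur i)) := by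
      funext i
      refine Fin.addCases (fun i => ?_) (fun i => ?_) i <;> simp
    rw [this, List.ofFn_fin_append, List.foldl_append, foldl_comp_append (List.ofFn fun i => φ i (dur i))
      (List.foldl _ _ _)]

theorem DR.of_reach {d : ℕ} {V0 : (Fin d → ℝ) → ℝ} {r τ : ℝ}
    {Φ : Phase d → Phase d} (h0 : 0 ≤ τ) (h : Reachable (torusHam V0) τ Φ) : DR V0 r τ Φ := by
  intro ρ hρ ε hε
  refine ⟨τ, h0, by linarith, Φ, h, ?_⟩
  simp [hε]

theorem IsTorusDensity.comp {d : ℕ} {r : ℝ} (hr : 1 ≤ r) {ρ : Phase d → ℝ}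
    (h : IsTorusDensity (ENNReal.ofReal r) ρ) {C : ENNReal} (hC : C ≠ ⊤) {G : Phase d → Phase d}
    (hG : Good C G) : IsTorusDensity (ENNReal.ofReal r) (fun x => ρ (G x)) := by
  obtain ⟨hρm, hρp, hρt⟩ := h
  have hp : ∀ k x, ρ (tsh k x) = ρ x := fun k x => hρp x.1 x.2 k
  refine ⟨hρm.comp hG.meas, fun q p k => ?_, (hG.eLpNorm_le r hr ρ hρm hp).trans_lt ?_⟩
  · have := hG.eqv k (q, p)
    rw [tsh] at this
    show ρ (G (sh k q, p)) = _
    rw [this, hp]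
  · exact ENNReal.mul_lt_top (ENNReal.rpow_lt_top_of_nonneg (by positivity) hC) hρt

theorem DR.comp {d : ℕ} {V0 : (Fin d → ℝ) → ℝ} {r : ℝ} (S : Setup V0 r) {T1 T2 : ℝ}
    {G1 G2 : Phase d → Phase d} (h1 : DR V0 r T1 G1) (h2 : DR V0 r T2 G2) {C1 C2 : ENNReal}
    (hC1 : C1 ≠ ⊤) (hG1 : Good C1 G1) (hG2 : Good C2 G2) : DR V0 r (T1 + T2) (G1 ∘ G2) := by
  intro ρ hρ ε hε
  obtain ⟨τ2, h02, hτ2, Φ2, hΦ2, he2⟩ := h2 (fun x => ρ (G1 x)) (hρ.comp S.hr hC1 hG1) (ε / 2) (by linarith)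
  obtain ⟨C, hC, hgC⟩ := hΦ2.good S
  have hCr : C ^ (1 / r) ≠ ⊤ := ENNReal.rpow_ne_top_of_nonneg (by have := S.hr; positivity) hC
  let c := (C ^ (1 / r)).toReal
  have hc : 0 ≤ c := ENNReal.toReal_nonneg
  obtain ⟨τ1, h01, hτ1, Φ1, hΦ1, he1⟩ := h1 ρ hρ (ε / 2 / (c + 1)) (by positivity)
  have hsm : ε / 2 / (c + 1) ≤ ε / 2 := div_le_self (by positivity) (by linarith)
  refine ⟨τ1 + τ2, by linarith, by linarith, Φ1 ∘ Φ2, hΦ1.comp hΦ2, ?_⟩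
  obtain ⟨D, hD, hgD⟩ := hΦ1.good S
  obtain ⟨hρm, hρp, hρt⟩ := hρ
  have hp : ∀ k x, ρ (tsh k x) = ρ x := fun k x => hρp x.1 x.2 k
  have hsplit : (fun x => ρ ((Φ1 ∘ Φ2) x) - ρ ((G1 ∘ G2) x)) =
      (fun x => (fun y => ρ (Φ1 y) - ρ (G1 y)) (Φ2 x)) + (fun x => ρ (G1 (Φ2 x)) - ρ (G1 (G2 x))) := by
    funext x; simp
  have mm : Measurable (fun y => ρ (Φ1 y) - ρ (G1 y)) := (hρm.comp hgD.meas).sub (hρm.comp hG1.meas)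
  have e3 := hgC.eLpNorm_le r S.hr (fun y => ρ (Φ1 y) - ρ (G1 y)) mm
    (fun k x => by rw [hgD.eqv, hG1.eqv, hp, hp])
  rw [hsplit]
  have hr1 : (1 : ENNReal) ≤ ENNReal.ofReal r := by simpa using S.hr
  refine (eLpNorm_add_le (mm.comp hgC.meas).aestronglyMeasurable
    (((hρm.comp hG1.meas).comp hgC.meas).sub ((hρm.comp hG1.meas).comp hG2.meas)).aestronglyMeasurable
    hr1).trans_lt ?_
  have e4 : C ^ (1 / r) * ENNReal.ofReal (ε / 2 / (c + 1)) ≤ ENNReal.ofReal (ε / 2) := by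
    rw [← ENNReal.ofReal_toReal hCr, ← ENNReal.ofReal_mul hc]
    apply ENNReal.ofReal_le_ofReal
    show c * (ε / 2 / (c + 1)) ≤ ε / 2
    rw [mul_div_assoc', div_le_iff₀ (by positivity)]
    nlinarith
  calc _ < ENNReal.ofReal (ε / 2) + ENNReal.ofReal (ε / 2) := by
        refine ENNReal.add_lt_add_of_le_of_lt ?_ ((e3.trans (mul_le_mul_right he1.le _)).trans e4) he2
        exact ne_top_of_le_ne_top ENNReal.ofReal_ne_top ((e3.trans (mul_le_mul_right he1.le _)).trans e4)
    _ = ENNReal.ofReal ε := by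
        rw [← ENNReal.ofReal_add (by linarith) (by linarith), add_halves]

open Filter Topology in
theorem DR.limit {d : ℕ} {V0 : (Fin d → ℝ) → ℝ} {r : ℝ} (S : Setup V0 r) (T : ℕ → ℝ) (T0 : ℝ)
    (hT : Tendsto T atTop (𝓝 T0)) (C : ℕ → ENNReal) (Gn : ℕ → Phase d → Phase d)
    (G : Phase d → Phase d) (hGn : ∀ n, Good (C n) (Gn n)) (hC : Tendsto C atTop (𝓝 1))
    (hG : Exact G)
    (hlim : ∀ᵐ x ∂(volume.restrict (torusBlock d)), Tendsto (fun n => Gn n x) atTop (𝓝 (G x)))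
    (hDR : ∀ n, DR V0 r (T n) (Gn n)) : DR V0 r T0 G := by
  intro ρ hρ ε hε
  have h1 := limit_lemma r S.hr C Gn G hGn hC hG hlim ρ hρ
  have h2 := h1.eventually_lt_const (u := ENNReal.ofReal (ε / 2)) (by simp [hε])
  have h3 := hT.eventually_lt_const (u := T0 + ε / 2) (by linarith)
  obtain ⟨n, hn1, hn2⟩ := (h2.and h3).exists
  obtain ⟨τ, h0, hτ, Φ, hΦ, he⟩ := hDR n ρ hρ (ε / 2) (by linarith)
  refine ⟨τ, h0, by linarith, Φ, hΦ, ?_⟩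
  obtain ⟨D, hD, hgD⟩ := hΦ.good S
  have hρm := hρ.1
  have hr1 : (1 : ENNReal) ≤ ENNReal.ofReal r := by simpa using S.hr
  have hsplit : (fun x => ρ (Φ x) - ρ (G x)) =
      (fun x => ρ (Φ x) - ρ (Gn n x)) + (fun x => ρ (Gn n x) - ρ (G x)) := by
    funext x; simp
  rw [hsplit]
  refine (eLpNorm_add_le ((hρm.comp hgD.meas).sub (hρm.comp (hGn n).meas)).aestronglyMeasurable
    ((hρm.comp (hGn n).meas).sub (hρm.comp hG.good.meas)).aestronglyMeasurable hr1).trans_lt ?_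
  calc _ < ENNReal.ofReal (ε / 2) + ENNReal.ofReal (ε / 2) := ENNReal.add_lt_add he hn1
    _ = ENNReal.ofReal ε := by
        rw [← ENNReal.ofReal_add (by linarith) (by linarith), add_halves]

theorem DR.mono {d : ℕ} {V0 : (Fin d → ℝ) → ℝ} {r : ℝ} {T1 T2 : ℝ}
    {G : Phase d → Phase d} (h : DR V0 r T1 G) (hT : T1 ≤ T2) : DR V0 r T2 G := by
  intro ρ hρ ε hε
  obtain ⟨τ, h0, hτ, h⟩ := h ρ hρ ε hε
  exact ⟨τ, h0, by linarith, h⟩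

open MeasureTheory Real

theorem reach_one {d : ℕ} {V0 : (Fin d → ℝ) → ℝ} {r : ℝ} (S : Setup V0 r) (u : Fin d → ℝ × ℝ)
    (φ : ℝ → Phase d → Phase d) (hφ : IsFlowOf (fld (fun q => a0 V0 q + wF u q)) φ) (t : ℝ)
    (ht : 0 ≤ t) : Reachable (torusHam V0) t (φ t) := by
  refine ⟨1, fun _ => t, fun _ => u, fun _ => φ, fun _ => ht, by simp, fun _ => ?_, ?_⟩
  · rw [hamVF_eq V0 S.hV0]; exact hφ
  · simp

open Filter Topology in
theorem const_tendsto (s : ℕ → ℝ) (hs : Tendsto s atTop (𝓝 0)) (m : ℕ) :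
    Tendsto (fun n => (ENNReal.ofReal (exp (s n))) ^ m) atTop (𝓝 1) := by
  have h1 : Tendsto (fun n => ENNReal.ofReal (exp (s n))) atTop (𝓝 1) := by
    have := ENNReal.tendsto_ofReal ((continuous_exp.tendsto 0).comp hs)
    simpa [Function.comp_def] using this
  have := ENNReal.Tendsto.pow (n := m) h1
  simpa using this

theorem wF_smul {d : ℕ} (s : ℝ) (u : Fin d → ℝ × ℝ) (q : Fin d → ℝ) :
    wF (s • u) q = s • wF u q := by
  funext i
  simp only [wF, Pi.smul_apply, Prod.smul_fst, Prod.smul_snd, smul_eq_mul, Finset.mul_sum]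
  exact Finset.sum_congr rfl fun j _ => by ring

open Filter Topology in
theorem tendsto_c : Tendsto (fun n : ℕ => (n : ℝ) + 1) atTop atTop :=
  tendsto_atTop_add_const_right _ _ tendsto_natCast_atTop_atTop

open Filter Topology in
theorem tendsto_s : Tendsto (fun n : ℕ => ((n : ℝ) + 1)⁻¹) atTop (𝓝 0) :=
  tendsto_c.inv_tendsto_atTop

theorem s_pos (n : ℕ) : 0 < ((n : ℝ) + 1)⁻¹ := by positivity

theorem s_le (n : ℕ) : ((n : ℝ) + 1)⁻¹ ≤ 1 := inv_le_one_of_one_le₀ (by simp)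

open Filter Topology in
theorem tendsto_of_norm_le {E : Type*} [NormedAddCommGroup E] {f g : ℕ → E} {a : E} {b : ℕ → ℝ}
    (hg : Tendsto g atTop (𝓝 a)) (hb : Tendsto b atTop (𝓝 0)) (h : ∀ n, ‖f n - g n‖ ≤ b n) :
    Tendsto f atTop (𝓝 a) := by
  have h1 : Tendsto (fun n => f n - g n) atTop (𝓝 0) := squeeze_zero_norm h hb
  simpa using h1.add hg

open Filter Topology in
theorem control_DR {d : ℕ} {V0 : (Fin d → ℝ) → ℝ} {r : ℝ} (S : Setup V0 r) (u : Fin d → ℝ × ℝ) :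
    DR V0 r 0 (VS (wF u)) := by
  obtain ⟨C0, K0, hC0, hK0⟩ := S.field
  obtain ⟨C1, hC1⟩ := periodic_bounded _ (wF_contDiff u).continuous (wF_per u)
  obtain ⟨K1, hK1⟩ := periodic_lip _ (wF_contDiff u) (wF_per u)
  let c : ℕ → NNReal := fun n => (n : NNReal) + 1
  have hcr : ∀ n, ((c n : NNReal) : ℝ) = (n : ℝ) + 1 := fun n => by simp [c]
  let a : ℕ → (Fin d → ℝ) → (Fin d → ℝ) := fun n q => a0 V0 q + wF ((c n : ℝ) • u) q
  have hC : ∀ n q, ‖a n q‖ ≤ (C0 + c n * C1 : NNReal) := by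
    intro n q
    simp only [a, wF_smul]
    refine (norm_add_le _ _).trans ?_
    rw [norm_smul]
    push_cast
    refine add_le_add (hC0 q) ?_
    rw [Real.norm_of_nonneg (c n).coe_nonneg]
    exact mul_le_mul_of_nonneg_left (hC1 q) (c n).2
  have hK : ∀ n, LipschitzWith (K0 + c n * K1) (a n) := by
    intro n
    refine hK0.add ?_
    have : LipschitzWith (c n * K1) (fun q => (c n : ℝ) • wF u q) := by
      apply LipschitzWith.of_dist_le_mul
      intro x y
      rw [dist_smul₀, Real.norm_of_nonneg (c n).coe_nonneg]
      push_cast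
      rw [mul_assoc]
      exact mul_le_mul_of_nonneg_left (hK1.dist_le_mul x y) (c n).2
    have e : wF ((c n : ℝ) • u) = fun q => (c n : ℝ) • wF u q := funext fun q => wF_smul _ _ _
    rw [← e] at this
    exact this
  choose φ hφ using fun n => exists_flow (a n) _ _ (hC n) (hK n)
  let s : ℕ → ℝ := fun n => ((n : ℝ) + 1)⁻¹
  have hs0 : ∀ n, 0 < s n := s_pos
  have hs1 : ∀ n, s n ≤ 1 := s_le
  have hs : Tendsto s atTop (𝓝 0) := tendsto_s
  have hcs : ∀ n, (c n : ℝ) * s n = 1 := fun n => by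
    rw [hcr]; exact mul_inv_cancel₀ (by positivity)
  have hper : ∀ n k q, a n (sh k q) = a n q := fun n k q => by
    simp only [a, a0_per V0 S.hper, wF_per]
  let A : ℝ := 1 + K0 + K1
  let M : ℕ → NNReal := fun n => ⟨A / √(s n), by positivity⟩
  have hgood : ∀ n, Good ((ENNReal.ofReal (exp (A * √(s n)))) ^ (2 * d)) (φ n (s n)) := by
    intro n
    have hl : 0 < √(s n) := Real.sqrt_pos.2 (hs0 n)
    have hl2 : √(s n) * √(s n) = s n := Real.mul_self_sqrt (hs0 n).le
    have hl1 : √(s n) ≤ 1 := Real.sqrt_le_one.2 (hs1 n)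
    have := flow_good (hK n) (hφ n) (fun q k => hper n k q) (√(s n)) hl (M n) (by
        show (√(s n))⁻¹ ≤ A / √(s n)
        rw [inv_eq_one_div]
        gcongr
        have h1 := K0.2
        have h2 := K1.2
        show 1 ≤ 1 + (K0 : ℝ) + K1
        linarith [K0.coe_nonneg, K1.coe_nonneg]) (by
        show √(s n) * ((K0 + c n * K1 : NNReal) : ℝ) ≤ A / √(s n)
        rw [le_div_iff₀ hl]
        push_cast
        have : √(s n) * (K0 + c n * K1) * √(s n) = s n * K0 + K1 := by
          calc _ = (√(s n) * √(s n)) * K0 + (c n * (√(s n) * √(s n))) * K1 := by ring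
            _ = _ := by rw [hl2, hcs]; ring
        rw [this]
        show _ ≤ 1 + (K0 : ℝ) + K1
        nlinarith [K0.coe_nonneg, hs1 n]) (s n) (hs0 n).le
    have e : ((M n : NNReal) : ℝ) * s n = A * √(s n) := by
      show A / √(s n) * s n = _
      nth_rewrite 2 [← hl2]
      field_simp
    rwa [e] at this
  refine DR.limit S s 0 hs (fun n => (ENNReal.ofReal (exp (A * √(s n)))) ^ (2 * d))
    (fun n => φ n (s n)) _ hgood (const_tendsto _ ?_ _)
    (VS_exact (wF_contDiff u).continuous.measurable (fun k q => wF_per u k q)) ?_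
    (fun n => DR.of_reach (hs0 n).le (reach_one S _ (φ n) (hφ n) (s n) (hs0 n).le))
  · have := ((Real.continuous_sqrt.tendsto 0).comp hs).const_mul A
    simpa [Function.comp_def] using this
  · refine Eventually.of_forall fun x => ?_
    have hCs : ∀ n, ((C0 + c n * C1 : NNReal) : ℝ) * s n = C0 * s n + C1 := fun n => by
      push_cast
      calc _ = C0 * s n + (c n * s n) * C1 := by ring
        _ = _ := by rw [hcs, one_mul]
    apply Tendsto.prodMk_nhds
    · refine tendsto_of_norm_le tendsto_const_nhds ?_
        (fun n => (flow_est (hφ n) _ (hC n) x (s n) (hs0 n).le).2.1)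
      simp only [hCs]
      have : Tendsto (fun n => (‖x.2‖ + (C0 * s n + C1)) * s n) atTop
          (𝓝 ((‖x.2‖ + (C0 * 0 + C1)) * 0)) :=
        (((hs.const_mul (C0 : ℝ)).add_const _).const_add _).mul hs
      simpa using this
    · have h1 : Tendsto (fun n => x.2 + s n • a n x.1) atTop (𝓝 (x.2 + wF u x.1)) := by
        have e : ∀ n, s n • a n x.1 = s n • a0 V0 x.1 + wF u x.1 := fun n => by
          simp only [a, wF_smul, smul_add, smul_smul]
          rw [mul_comm (s n), hcs, one_smul]
        simp only [e]
        have : Tendsto (fun n => x.2 + (s n • a0 V0 x.1 + wF u x.1)) atTop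
            (𝓝 (x.2 + ((0:ℝ) • a0 V0 x.1 + wF u x.1))) :=
          ((hs.smul_const _).add_const _).const_add _
        simpa using this
      have e : ∀ n, ((K0 + c n * K1 : NNReal) : ℝ) * ((‖x.2‖ + (C0 + c n * C1 : NNReal) * s n) * s n) * s n
          = (K0 * s n + K1) * (‖x.2‖ + (C0 * s n + C1)) * s n := fun n => by
        rw [hCs]
        push_cast
        calc _ = (K0 * s n + (c n * s n) * K1) * (‖x.2‖ + (C0 * s n + C1)) * s n := by ring
          _ = _ := by rw [hcs, one_mul]
      refine tendsto_of_norm_le h1 (b := fun n => (K0 * s n + K1) * (‖x.2‖ + (C0 * s n + C1)) * s n) ?_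
        (fun n => by
          rw [← e, ← sub_sub]
          exact flow_est2 (hφ n) _ (hC n) (hK n) x (s n) (hs0 n).le)
      have : Tendsto (fun n => (K0 * s n + K1) * (‖x.2‖ + (C0 * s n + C1)) * s n) atTop
          (𝓝 ((K0 * 0 + K1) * (‖x.2‖ + (C0 * 0 + C1)) * 0)) :=
        (((hs.const_mul (K0 : ℝ)).add_const _).mul (((hs.const_mul (C0 : ℝ)).add_const _).const_add _)).mul hs
      simpa using this

/-- the free flow and its properties -/
structure FreeFlow {d : ℕ} (V0 : (Fin d → ℝ) → ℝ) (r : ℝ) (F : ℝ → Phase d → Phase d) (A C : ℝ) :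
    Prop where
  hC : 0 ≤ C
  dr : ∀ t, 0 ≤ t → DR V0 r t (F t)
  good : ∀ t, 0 ≤ t → Good ((ENNReal.ofReal (exp (A * t))) ^ (2 * d)) (F t)
  est2 : ∀ x t, 0 ≤ t → ‖(F t x).2 - x.2‖ ≤ C * t
  est1 : ∀ x t, 0 ≤ t → ‖(F t x).1 - x.1 - t • x.2‖ ≤ C * t * t

theorem exists_free {d : ℕ} {V0 : (Fin d → ℝ) → ℝ} {r : ℝ} (S : Setup V0 r) :
    ∃ F A C, FreeFlow V0 r F A C := by
  obtain ⟨C0, K0, hC0, hK0⟩ := S.field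
  obtain ⟨φ, hφ⟩ := exists_flow (a0 V0) _ _ hC0 hK0
  have e : (fun q => a0 V0 q + wF 0 q) = a0 V0 := by
    funext q i; simp [wF]
  refine ⟨φ, (max 1 K0 : NNReal), C0, C0.2, fun t ht => DR.of_reach ht (reach_one S 0 φ ?_ t ht),
    fun t ht => flow_good hK0 hφ (fun q k => a0_per V0 S.hper k q) 1 one_pos (max 1 K0) (by simp)
      (by simp) t ht, fun x t ht => (flow_est hφ _ hC0 x t ht).1,
      fun x t ht => (flow_est hφ _ hC0 x t ht).2.2⟩
  rw [e]; exact hφ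

theorem VS_comp_DR {d : ℕ} {V0 : (Fin d → ℝ) → ℝ} {r : ℝ} (S : Setup V0 r)
    {v w : (Fin d → ℝ) → (Fin d → ℝ)} (hv : Measurable v) (hw : Measurable w)
    (pv : ∀ k q, v (sh k q) = v q) (pw : ∀ k q, w (sh k q) = w q)
    (h1 : DR V0 r 0 (VS v)) (h2 : DR V0 r 0 (VS w)) : DR V0 r 0 (VS (fun q => v q + w q)) := by
  have := h1.comp S h2 (by simp) (VS_good hv pv) (VS_good hw pw)
  have e : VS v ∘ VS w = VS (fun q => v q + w q) := by
    funext x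
    simp [VS, add_assoc, add_comm (w x.1)]
  rw [e, add_zero] at this
  exact this

open Filter Topology in
theorem VS_limit {d : ℕ} {V0 : (Fin d → ℝ) → ℝ} {r : ℝ} (S : Setup V0 r)
    (v : ℕ → (Fin d → ℝ) → (Fin d → ℝ)) (w : (Fin d → ℝ) → (Fin d → ℝ))
    (hv : ∀ n, Measurable (v n)) (hw : Measurable w)
    (pv : ∀ n k q, v n (sh k q) = v n q) (pw : ∀ k q, w (sh k q) = w q)
    (hlim : ∀ᵐ q : Fin d → ℝ, Tendsto (fun n => v n q) atTop (𝓝 (w q)))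
    (h : ∀ n, DR V0 r 0 (VS (v n))) : DR V0 r 0 (VS w) := by
  refine DR.limit S (fun _ => 0) 0 tendsto_const_nhds (fun _ => 1) (fun n => VS (v n)) _
    (fun n => VS_good (hv n) (pv n)) tendsto_const_nhds (VS_exact hw pw) ?_ h
  apply ae_restrict_of_ae
  have := (Measure.quasiMeasurePreserving_fst (μ := (volume : Measure (Fin d → ℝ)))
    (ν := (volume : Measure (Fin d → ℝ)))).ae hlim
  filter_upwards [this] with x hx
  exact tendsto_const_nhds.prodMk_nhds (hx.const_add _)

open Filter Topology in
theorem saturation {d : ℕ} {V0 : (Fin d → ℝ) → ℝ} {r : ℝ} (S : Setup V0 r)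
    (w : (Fin d → ℝ) → (Fin d → ℝ)) (hw : ContDiff ℝ 1 w) (pw : ∀ k q, w (sh k q) = w q)
    (h : ∀ s : ℝ, DR V0 r 0 (VS (fun q => s • w q))) :
    DR V0 r 0 (VS (fun q => -(fderiv ℝ w q (w q)))) := by
  obtain ⟨F, A, C, hF⟩ := exists_free S
  let s : ℕ → ℝ := fun n => ((n : ℝ) + 1)⁻¹
  have hs0 : ∀ n, 0 < s n := s_pos
  have hs : Tendsto s atTop (𝓝 0) := tendsto_s
  have hwm := hw.continuous.measurable
  have hg : ∀ c : ℝ, Good 1 (VS (fun q => c • w q)) := fun c =>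
    VS_good (hwm.const_smul c) (fun k q => by simp [pw])
  have hdm : Continuous (fun q => -(fderiv ℝ w q (w q))) :=
    ((hw.continuous_fderiv one_ne_zero).clm_apply hw.continuous).neg
  have hdp : ∀ k q, fderiv ℝ w (sh k q) = fderiv ℝ w q := by
    intro k q
    have : (fun q => w (q + fun i => 2 * Real.pi * (k i : ℝ))) = w := by
      funext q; exact pw k q
    rw [sh_eq, ← fderiv_comp_add_right, this]
  have hs2 : ∀ n, 0 ≤ s n ^ 2 := fun n => sq_nonneg _
  refine DR.limit S (fun n => 0 + (s n ^ 2 + 0)) 0 (by simpa using hs.pow 2)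
    (fun n => 1 * ((ENNReal.ofReal (exp (A * s n ^ 2))) ^ (2 * d) * 1))
    (fun n => VS (fun q => (s n)⁻¹ • w q) ∘ (F (s n ^ 2) ∘ VS (fun q => (-(s n)⁻¹) • w q))) _
    (fun n => (hg _).comp ((hF.good _ (hs2 n)).comp (hg _))) ?_
    (VS_exact hdm.measurable (fun k q => by simp only [hdp, pw])) ?_
    (fun n => (h _).comp S ((hF.dr _ (hs2 n)).comp S (h _) (by finiteness) (hF.good _ (hs2 n)) (hg _))
      (by simp) (hg _) ((hF.good _ (hs2 n)).comp (hg _)))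
  · simp only [one_mul, mul_one]
    refine const_tendsto _ ?_ _
    simpa using (hs.pow 2).const_mul A
  · refine Eventually.of_forall fun x => ?_
    let y : ℕ → Phase d := fun n => F (s n ^ 2) (VS (fun q => (-(s n)⁻¹) • w q) x)
    have hy2 : ∀ n, ‖(y n).2 - (x.2 - (s n)⁻¹ • w x.1)‖ ≤ C * s n ^ 2 := fun n => by
      have := hF.est2 (VS (fun q => (-(s n)⁻¹) • w q) x) (s n ^ 2) (hs2 n)
      have e : x.2 - (s n)⁻¹ • w x.1 = x.2 + (-(s n)⁻¹) • w x.1 := by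
        rw [neg_smul, sub_eq_add_neg]
      rw [e]; exact this
    have hy1 : ∀ n, ‖(y n).1 - x.1 - (s n ^ 2 • x.2 - s n • w x.1)‖ ≤ C * s n ^ 2 * s n ^ 2 := fun n => by
      have := hF.est1 (VS (fun q => (-(s n)⁻¹) • w q) x) (s n ^ 2) (hs2 n)
      have e : s n ^ 2 • (x.2 + (-(s n)⁻¹) • w x.1) = s n ^ 2 • x.2 - s n • w x.1 := by
        rw [smul_add, smul_smul, sub_eq_add_neg, ← neg_smul]
        congr 2
        have := (hs0 n).ne'
        field_simp
      simp only [VS, e] at this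
      exact this
    have hq : Tendsto (fun n => (s n)⁻¹ • ((y n).1 - x.1)) atTop (𝓝 (-(w x.1))) := by
      have h1 : Tendsto (fun n => s n • x.2 - w x.1) atTop (𝓝 ((0:ℝ) • x.2 - w x.1)) :=
        (hs.smul_const _).sub_const _
      rw [zero_smul, zero_sub] at h1
      refine tendsto_of_norm_le h1 (b := fun n => C * s n ^ 3) (by simpa using (hs.pow 3).const_mul C)
        (fun n => ?_)
      have e : (s n)⁻¹ • ((y n).1 - x.1) - (s n • x.2 - w x.1) =
          (s n)⁻¹ • ((y n).1 - x.1 - (s n ^ 2 • x.2 - s n • w x.1)) := by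
        have := (hs0 n).ne'
        simp only [smul_sub, smul_smul]
        have e1 : (s n)⁻¹ * s n ^ 2 = s n := by field_simp
        have e2 : (s n)⁻¹ * s n = 1 := by field_simp
        rw [e1, e2, one_smul]
      rw [e, norm_smul, norm_inv, Real.norm_of_nonneg (hs0 n).le, inv_mul_le_iff₀ (hs0 n)]
      refine (hy1 n).trans (le_of_eq (by ring))
    have hq0 : Tendsto (fun n => (y n).1) atTop (𝓝 x.1) := by
      have h1 := hs.smul hq
      rw [zero_smul] at h1
      have h2 := h1.const_add x.1
      rw [add_zero] at h2
      refine h2.congr fun n => ?_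
      rw [smul_smul, mul_inv_cancel₀ (hs0 n).ne', one_smul]; abel
    have hlim := HasFDerivWithinAt.lim (s := Set.univ)
      ((hw.differentiable one_ne_zero).differentiableAt (x := x.1)).hasFDerivAt.hasFDerivWithinAt
      (l := atTop) (c := fun n => (s n)⁻¹) (d := fun n => (y n).1 - x.1) (v := -(w x.1))
      (by simpa using hq0.sub_const x.1) (by simp) hq
    apply Tendsto.prodMk_nhds
    · exact hq0
    · have h1 : Tendsto (fun n => x.2 + (s n)⁻¹ • (w (x.1 + ((y n).1 - x.1)) - w x.1)) atTop
          (𝓝 (x.2 + -(fderiv ℝ w x.1 (w x.1)))) := by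
        have := hlim.const_add x.2
        rwa [map_neg] at this
      refine tendsto_of_norm_le h1 (b := fun n => C * s n ^ 2) (by simpa using (hs.pow 2).const_mul C)
        (fun n => ?_)
      refine le_trans (le_of_eq ?_) (hy2 n)
      congr 1
      show (y n).2 + (s n)⁻¹ • w (y n).1 - _ = _
      rw [add_sub_cancel, smul_sub]
      abel

open MeasureTheory Real

/-- a single Fourier mode vector field -/
noncomputable def WW {d : ℕ} (k : Fin d → ℤ) (c θ : ℝ) (q : Fin d → ℝ) : Fin d → ℝ :=
  (c * sin (dotZ k q + θ)) • vecZ k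

/-- linear form of a frequency -/
noncomputable def dotL {d : ℕ} (k : Fin d → ℤ) : (Fin d → ℝ) →L[ℝ] ℝ :=
  ∑ i, (k i : ℝ) • ContinuousLinearMap.proj (R := ℝ) (φ := fun _ : Fin d => ℝ) i

theorem dotL_apply {d : ℕ} (k : Fin d → ℤ) (q : Fin d → ℝ) : dotL k q = dotZ k q := by
  simp [dotL, dotZ]

theorem dotZ_fderiv {d : ℕ} (k : Fin d → ℤ) (q : Fin d → ℝ) : HasFDerivAt (dotZ k) (dotL k) q := by
  have : dotZ k = dotL k := funext fun q => (dotL_apply k q).symm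
  rw [this]; exact (dotL k).hasFDerivAt

theorem WW_per {d : ℕ} (k : Fin d → ℤ) (c θ : ℝ) (m : Fin d → ℤ) (q : Fin d → ℝ) :
    WW k c θ (sh m q) = WW k c θ q := by
  unfold WW
  rw [dotZ_sh, add_right_comm, Real.sin_add_int_mul_two_pi]

theorem WW_contDiff {d : ℕ} (k : Fin d → ℤ) (c θ : ℝ) : ContDiff ℝ 1 (WW k c θ) := by
  have := (dotZ_contDiff k).of_le (m := 1) (by exact_mod_cast le_top)
  exact (contDiff_const.mul (this.add contDiff_const).sin).smul contDiff_const

theorem WW_fderiv {d : ℕ} (k : Fin d → ℤ) (c θ : ℝ) (q : Fin d → ℝ) (v : Fin d → ℝ) :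
    fderiv ℝ (WW k c θ) q v = (c * cos (dotZ k q + θ) * dotZ k v) • vecZ k := by
  have := (((dotZ_fderiv k q).add_const θ).sin.const_mul c).smul_const (vecZ k)
  have h2 : fderiv ℝ (WW k c θ) q = _ := this.fderiv
  rw [h2]
  simp [dotL_apply, mul_assoc]

theorem WW_smul {d : ℕ} (k : Fin d → ℤ) (c θ s : ℝ) (q : Fin d → ℝ) :
    s • WW k c θ q = WW k (s * c) θ q := by
  simp [WW, smul_smul, mul_assoc]

theorem dotZ_add {d : ℕ} (k l : Fin d → ℤ) (q : Fin d → ℝ) : dotZ (k + l) q = dotZ k q + dotZ l q := by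
  simp [dotZ, add_mul, Finset.sum_add_distrib]

theorem dotZ_neg {d : ℕ} (k : Fin d → ℤ) (q : Fin d → ℝ) : dotZ (-k) q = -dotZ k q := by
  simp [dotZ]

theorem dotZ_lin {d : ℕ} (k : Fin d → ℤ) (a b : ℝ) (q q' : Fin d → ℝ) :
    dotZ k (a • q + b • q') = a * dotZ k q + b * dotZ k q' := by
  simp only [← dotL_apply, map_add, map_smul, smul_eq_mul]

/-- attainable frequencies -/
def InB {d : ℕ} (V0 : (Fin d → ℝ) → ℝ) (r : ℝ) (k : Fin d → ℤ) : Prop :=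
  ∀ c θ, DR V0 r 0 (VS (WW k c θ))

theorem InB_ctrl {d : ℕ} {V0 : (Fin d → ℝ) → ℝ} {r : ℝ} (S : Setup V0 r) (j : Fin d) :
    InB V0 r (kvecZ d j) := by
  intro c θ
  have := control_DR S (Pi.single j (c * cos θ, -(c * sin θ)))
  have e : wF (Pi.single j (c * cos θ, -(c * sin θ))) = WW (kvecZ d j) c θ := by
    funext q i
    simp only [wF, WW, Pi.smul_apply, smul_eq_mul, vecZ]
    rw [Finset.sum_eq_single j]
    · rw [Pi.single_eq_same, sin_add, kvec_cast]; ring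
    · intro b _ hb
      rw [Pi.single_eq_of_ne hb]; simp
    · simp
  rwa [e] at this

theorem InB_zero {d : ℕ} {V0 : (Fin d → ℝ) → ℝ} {r : ℝ} (S : Setup V0 r) : InB V0 r 0 := by
  intro c θ
  have := control_DR S 0
  have e : wF (0 : Fin d → ℝ × ℝ) = WW 0 c θ := by
    funext q i
    simp [wF, WW, vecZ]
  rwa [e] at this

theorem InB_neg {d : ℕ} {V0 : (Fin d → ℝ) → ℝ} {r : ℝ} {k : Fin d → ℤ} (h : InB V0 r k) :
    InB V0 r (-k) := by
  intro c θ
  have e : WW (-k) c θ = WW k c (-θ) := by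
    funext q i
    simp only [WW, dotZ_neg, vecZ, Pi.smul_apply, smul_eq_mul, Pi.neg_apply]
    have : -dotZ k q + θ = -(dotZ k q + -θ) := by ring
    rw [this, sin_neg]; push_cast; ring
  rw [e]; exact h _ _

theorem InB_pair {d : ℕ} {V0 : (Fin d → ℝ) → ℝ} {r : ℝ} (S : Setup V0 r) {k l : Fin d → ℤ}
    (hk : InB V0 r k) (hl : InB V0 r l) (a θ φ : ℝ) :
    DR V0 r 0 (VS (fun q => -(fderiv ℝ (fun q => WW k a θ q + WW l 1 φ q) q (WW k a θ q + WW l 1 φ q)))) := by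
  refine saturation S (fun q => WW k a θ q + WW l 1 φ q) ((WW_contDiff _ _ _).add (WW_contDiff _ _ _))
    (fun m q => by simp only [WW_per]) fun s => ?_
  simp only [smul_add, WW_smul]
  exact VS_comp_DR S (WW_contDiff _ _ _).continuous.measurable (WW_contDiff _ _ _).continuous.measurable
    (WW_per _ _ _) (WW_per _ _ _) (hk _ _) (hl _ _)

theorem InB_add {d : ℕ} {V0 : (Fin d → ℝ) → ℝ} {r : ℝ} (S : Setup V0 r) {k l : Fin d → ℤ}
    (hk : InB V0 r k) (hl : InB V0 r l) (hkl : dotZ k (vecZ l) ≠ 0) : InB V0 r (k + l) := by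
  intro c θ
  have hsym : dotZ l (vecZ k) = dotZ k (vecZ l) := by
    simp only [dotZ, vecZ]; exact Finset.sum_congr rfl fun i _ => mul_comm _ _
  set κ := dotZ k (vecZ l) with hκ
  let a : ℝ := -c / κ
  have hfd : ∀ θ φ q, fderiv ℝ (fun q => WW k a θ q + WW l 1 φ q) q (WW k a θ q + WW l 1 φ q) =
      (a * cos (dotZ k q + θ) * (a * sin (dotZ k q + θ) * dotZ k (vecZ k) + sin (dotZ l q + φ) * κ)) • vecZ k
      + (cos (dotZ l q + φ) * (a * sin (dotZ k q + θ) * κ + sin (dotZ l q + φ) * dotZ l (vecZ l))) • vecZ l := by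
    intro θ φ q
    rw [fderiv_fun_add ((WW_contDiff k a θ).differentiable one_ne_zero q)
      ((WW_contDiff l 1 φ).differentiable one_ne_zero q), add_apply, WW_fderiv, WW_fderiv]
    unfold WW
    rw [dotZ_lin, dotZ_lin, hsym, ← hκ]
    simp only [one_mul]
  have hc : ∀ θ φ, Measurable (fun q => -(fderiv ℝ (fun q => WW k a θ q + WW l 1 φ q) q (WW k a θ q + WW l 1 φ q))) := by
    intro θ φ
    have hw := ((WW_contDiff k a θ).add (WW_contDiff l 1 φ))
    exact ((hw.continuous_fderiv one_ne_zero).clm_apply hw.continuous).neg.measurable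
  have hp : ∀ θ φ m q, -(fderiv ℝ (fun q => WW k a θ q + WW l 1 φ q) (sh m q) (WW k a θ (sh m q) + WW l 1 φ (sh m q)))
     = -(fderiv ℝ (fun q => WW k a θ q + WW l 1 φ q) q (WW k a θ q + WW l 1 φ q)) := by
    intro θ φ m q
    rw [hfd, hfd, dotZ_sh, dotZ_sh]
    simp only [add_right_comm _ _ θ, add_right_comm _ _ φ, Real.sin_add_int_mul_two_pi, Real.cos_add_int_mul_two_pi]
  have := VS_comp_DR S (hc θ 0) (hc (θ + π / 2) (0 - π / 2)) (hp _ _) (hp _ _)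
    (InB_pair S hk hl a θ 0) (InB_pair S hk hl a (θ + π / 2) (0 - π / 2))
  have e : WW (k + l) c θ = fun q => -(fderiv ℝ (fun q => WW k a θ q + WW l 1 0 q) q (WW k a θ q + WW l 1 0 q))
     + -(fderiv ℝ (fun q => WW k a (θ + π / 2) q + WW l 1 (0 - π / 2) q) q (WW k a (θ + π / 2) q + WW l 1 (0 - π / 2) q)) := by
    funext q i
    rw [hfd, hfd]
    simp only [← add_assoc, add_zero, WW, dotZ_add, zero_sub, ← sub_eq_add_neg, sin_add_pi_div_two, cos_add_pi_div_two,
      sin_sub_pi_div_two, cos_sub_pi_div_two]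
    simp only [Pi.add_apply, Pi.neg_apply, Pi.sub_apply, Pi.smul_apply, smul_eq_mul, vecZ]
    rw [add_right_comm, sin_add]
    have : c = -(a * κ) := by simp only [a]; field_simp
    rw [this]
    push_cast
    ring
  rw [e]; exact this

theorem InB_single_mul {d : ℕ} {V0 : (Fin d → ℝ) → ℝ} {r : ℝ} (S : Setup V0 r) {i : Fin d}
    (h : InB V0 r (Pi.single i 1)) (n : ℤ) : InB V0 r (Pi.single i n) := by
  have hn : ∀ n : ℕ, InB V0 r (Pi.single i (n : ℤ)) := by
    intro n
    induction n with
    | zero => simpa using InB_zero S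
    | succ n ih =>
      by_cases hn : n = 0
      · subst hn; simpa using h
      · have := InB_add S ih h (by
          simp only [dotZ, vecZ]
          rw [Finset.sum_eq_single i] <;> simp +contextual [hn, Pi.single_apply])
        rw [← Pi.single_add] at this
        simpa using this
  obtain ⟨m, rfl | rfl⟩ := n.eq_nat_or_neg
  · exact hn m
  · have := InB_neg (hn m)
    rwa [← Pi.single_neg] at this

theorem InB_change {d : ℕ} {V0 : (Fin d → ℝ) → ℝ} {r : ℝ} (S : Setup V0 r) (k : Fin d → ℤ)
    (h1 : InB V0 r (fun _ => 1)) (s : Finset (Fin d)) (h : ∀ i ∈ s, InB V0 r (Pi.single i 1)) :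
    InB V0 r (fun j => if j ∈ s then k j else 1) := by
  induction s using Finset.induction_on with
  | empty => simpa using h1
  | insert i s hi ih =>
    have ih := ih fun j hj => h j (Finset.mem_insert_of_mem hj)
    have e : (fun j => if j ∈ insert i s then k j else 1) =
        (fun j => if j ∈ s then k j else 1) + Pi.single i (k i - 1) := by
      funext j
      by_cases hj : j = i
      · subst hj; simp [hi]
      · simp [hj]
    rw [e]
    by_cases hk : k i - 1 = 0
    · rw [hk]; simpa using ih
    · refine InB_add S ih (InB_single_mul S (h i (Finset.mem_insert_self _ _)) _) ?_
      simp only [dotZ, vecZ]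
      rw [Finset.sum_eq_single i]
      · simp [hi]; exact_mod_cast hk
      · intro b _ hb; simp [hb]
      · simp

theorem InB_all {d : ℕ} {V0 : (Fin d → ℝ) → ℝ} {r : ℝ} (S : Setup V0 r) (k : Fin d → ℤ) :
    InB V0 r k := by
  rcases Nat.eq_zero_or_pos d with hd | hd
  · subst hd
    rw [Subsingleton.elim k 0]; exact InB_zero S
  · let last : Fin d := ⟨d - 1, by omega⟩
    have h1 : InB V0 r (fun _ : Fin d => (1:ℤ)) := by
      have := InB_ctrl S last
      simpa [kvecZ, last] using this
    have hn : ∀ i : Fin d, i ≠ last → InB V0 r (Pi.single i 1) := by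
      intro i hi
      have := InB_ctrl S i
      have h : (i : ℕ) < d - 1 := by
        have : (i : ℕ) ≠ d - 1 := fun h => hi (Fin.ext h)
        omega
      simpa [kvecZ, h] using this
    have hl : InB V0 r (Pi.single last 1) := by
      have := InB_change S 0 h1 (Finset.univ.erase last) (fun i hi => hn i (Finset.ne_of_mem_erase hi))
      convert this using 1
      funext j
      by_cases hj : j = last
      · subst hj; simp
      · simp [hj]
    have := InB_change S k h1 Finset.univ (fun i _ => by
      by_cases hi : i = last
      · subst hi; exact hl
      · exact hn i hi)
    simpa using this

open MeasureTheory Real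

/-- complex attainable fields -/
structure AC {d : ℕ} (V0 : (Fin d → ℝ) → ℝ) (r : ℝ) (w : (Fin d → ℝ) → (Fin d → ℂ)) : Prop where
  meas : Measurable w
  per : ∀ k q, w (sh k q) = w q
  dr : ∀ c : ℂ, DR V0 r 0 (VS (fun q i => (c * w q i).re))

theorem AC.rmeas {d : ℕ} {w : (Fin d → ℝ) → (Fin d → ℂ)} (h : Measurable w) (c : ℂ) :
    Measurable (fun (q : Fin d → ℝ) (i : Fin d) => (c * w q i).re) :=
  measurable_pi_iff.2 fun i =>
    Complex.measurable_re.comp (((measurable_pi_apply i).comp h).const_mul c)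

theorem AC.add {d : ℕ} {V0 : (Fin d → ℝ) → ℝ} {r : ℝ} (S : Setup V0 r)
    {v w : (Fin d → ℝ) → (Fin d → ℂ)} (hv : AC V0 r v) (hw : AC V0 r w) :
    AC V0 r (fun q => v q + w q) := by
  refine ⟨hv.meas.add hw.meas, fun k q => by rw [hv.per, hw.per], fun c => ?_⟩
  have := VS_comp_DR S (AC.rmeas hv.meas c) (AC.rmeas hw.meas c) (fun k q => by simp only [hv.per])
    (fun k q => by simp only [hw.per]) (hv.dr c) (hw.dr c)
  convert this using 3 with q
  funext i
  simp [mul_add]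

theorem AC.smul {d : ℕ} {V0 : (Fin d → ℝ) → ℝ} {r : ℝ}
    {v : (Fin d → ℝ) → (Fin d → ℂ)} (hv : AC V0 r v) (a : ℂ) :
    AC V0 r (fun q => a • v q) := by
  refine ⟨hv.meas.const_smul a, fun k q => by rw [hv.per], fun c => ?_⟩
  have := hv.dr (c * a)
  simpa [mul_assoc] using this

theorem AC.zero {d : ℕ} {V0 : (Fin d → ℝ) → ℝ} {r : ℝ} (S : Setup V0 r) :
    AC V0 r (fun _ => 0) := by
  refine ⟨measurable_const, fun k q => rfl, fun c => ?_⟩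
  have := InB_zero S 0 0
  convert this using 2 
  funext q i
  simp [WW]

theorem AC.sum {d : ℕ} {V0 : (Fin d → ℝ) → ℝ} {r : ℝ} (S : Setup V0 r) {ι : Type*} (s : Finset ι)
    (v : ι → (Fin d → ℝ) → (Fin d → ℂ)) (hv : ∀ i ∈ s, AC V0 r (v i)) :
    AC V0 r (fun q => ∑ i ∈ s, v i q) := by
  classical
  induction s using Finset.induction_on with
  | empty => simpa using AC.zero S
  | insert i s hi ih =>
    simp only [Finset.sum_insert hi]
    exact (hv i (Finset.mem_insert_self _ _)).add S
      (ih fun j hj => hv j (Finset.mem_insert_of_mem hj))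

open Filter Topology in
theorem AC.limit {d : ℕ} {V0 : (Fin d → ℝ) → ℝ} {r : ℝ} (S : Setup V0 r)
    {v : ℕ → (Fin d → ℝ) → (Fin d → ℂ)} {w : (Fin d → ℝ) → (Fin d → ℂ)}
    (hv : ∀ n, AC V0 r (v n)) (hm : Measurable w) (hp : ∀ k q, w (sh k q) = w q)
    (hlim : ∀ᵐ q : Fin d → ℝ, Tendsto (fun n => v n q) atTop (𝓝 (w q))) : AC V0 r w := by
  refine ⟨hm, hp, fun c => ?_⟩
  refine VS_limit S (fun n q i => (c * v n q i).re) _ (fun n => AC.rmeas (hv n).meas c) (AC.rmeas hm c)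
    (fun n k q => by simp only [(hv n).per]) (fun k q => by simp only [hp]) ?_ (fun n => (hv n).dr c)
  filter_upwards [hlim] with q hq
  rw [tendsto_pi_nhds] at hq ⊢
  intro i
  exact (Complex.continuous_re.tendsto _).comp ((hq i).const_mul c)

theorem AC.congr {d : ℕ} {V0 : (Fin d → ℝ) → ℝ} {r : ℝ} (S : Setup V0 r)
    {v : (Fin d → ℝ) → (Fin d → ℂ)} {w : (Fin d → ℝ) → (Fin d → ℂ)}
    (hv : AC V0 r v) (hm : Measurable w) (hp : ∀ k q, w (sh k q) = w q)
    (he : ∀ᵐ q : Fin d → ℝ, v q = w q) : AC V0 r w := by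
  refine AC.limit S (fun _ => hv) hm hp ?_
  filter_upwards [he] with q hq
  rw [hq]; exact tendsto_const_nhds

/-- exponential mode -/
noncomputable def EE {d : ℕ} (k : Fin d → ℤ) (q : Fin d → ℝ) : ℂ := Complex.exp (dotZ k q * Complex.I)

theorem EE_cont {d : ℕ} (k : Fin d → ℤ) : Continuous (EE k) := by
  unfold EE
  have := (dotZ_contDiff k).continuous
  fun_prop

theorem EE_per {d : ℕ} (k m : Fin d → ℤ) (q : Fin d → ℝ) : EE k (sh m q) = EE k q := by
  unfold EE
  rw [dotZ_sh]
  push_cast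
  rw [add_mul, Complex.exp_add]
  have : ((∑ i, (k i : ℂ) * (m i : ℂ)) * (2 * (π : ℂ)) * Complex.I) =
    ((∑ i, k i * m i : ℤ) : ℂ) * (2 * π * Complex.I) := by push_cast; ring
  rw [this, Complex.exp_int_mul_two_pi_mul_I, mul_one]

theorem EE_add {d : ℕ} (k l : Fin d → ℤ) (q : Fin d → ℝ) : EE (k + l) q = EE k q * EE l q := by
  unfold EE
  rw [dotZ_add, ← Complex.exp_add]; push_cast; ring_nf

theorem EE_norm {d : ℕ} (k : Fin d → ℤ) (q : Fin d → ℝ) : ‖EE k q‖ = 1 := Complex.norm_exp_ofReal_mul_I _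

theorem EE_neg {d : ℕ} (k : Fin d → ℤ) (q : Fin d → ℝ) : EE (-k) q = (EE k q)⁻¹ := by
  unfold EE
  rw [dotZ_neg, ← Complex.exp_neg]; push_cast; ring_nf

theorem EE_nsmul {d : ℕ} (k : Fin d → ℤ) (n : ℕ) (q : Fin d → ℝ) : EE (n • k) q = (EE k q) ^ n := by
  induction n with
  | zero => simp [EE, dotZ]
  | succ n ih => rw [succ_nsmul, EE_add, ih, pow_succ]

theorem AC_base {d : ℕ} {V0 : (Fin d → ℝ) → ℝ} {r : ℝ} (S : Setup V0 r) (k : Fin d → ℤ) :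
    AC V0 r (fun q i => (k i : ℂ) * EE k q) := by
  refine ⟨measurable_pi_iff.2 fun i => ((EE_cont k).measurable.const_mul _), fun m q => by
    simp only [EE_per], fun c => ?_⟩
  have := InB_all S k ‖c‖ (c.arg + π / 2)
  convert this using 2
  funext q i
  simp only [WW, vecZ, Pi.smul_apply, smul_eq_mul, ← add_assoc, sin_add_pi_div_two]
  have h : c * (k i * EE k q) = ((‖c‖ * k i : ℝ) : ℂ) * Complex.exp ((dotZ k q + c.arg : ℝ) * Complex.I) := by
    nth_rewrite 1 [← Complex.norm_mul_exp_arg_mul_I c]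
    push_cast
    rw [add_mul, Complex.exp_add, EE]; ring
  rw [h, Complex.re_ofReal_mul, Complex.exp_ofReal_mul_I_re]; ring

theorem AC_term {d : ℕ} {V0 : (Fin d → ℝ) → ℝ} {r : ℝ} (S : Setup V0 r) (l κ : Fin d → ℤ)
    (ρ : ℝ) (m : ℕ) :
    AC V0 r (fun q i => EE l q * ((l i : ℂ) * ((ρ * EE κ q) ^ (m + 1) / ((m + 1 : ℕ) : ℂ)
        - (ρ * (EE κ q)⁻¹) ^ (m + 1) / ((m + 1 : ℕ) : ℂ)) +
        (κ i : ℂ) * ((ρ * EE κ q) ^ (m + 1) + (ρ * (EE κ q)⁻¹) ^ (m + 1)))) := by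
  have h1 := (AC_base S (l + (m + 1) • κ)).smul ((ρ : ℂ) ^ (m + 1) / ((m + 1 : ℕ) : ℂ))
  have h2 := (AC_base S (l + -((m + 1) • κ))).smul (-((ρ : ℂ) ^ (m + 1) / ((m + 1 : ℕ) : ℂ)))
  convert h1.add S h2 using 1
  funext q i
  simp only [Pi.add_apply, Pi.smul_apply, smul_eq_mul, EE_add, EE_neg, EE_nsmul]
  have : ((m + 1 : ℕ) : ℂ) ≠ 0 := by exact_mod_cast Nat.succ_ne_zero m
  have hsm : ((m + 1) • κ) i = ((m + 1 : ℕ) : ℤ) * κ i := by rw [Pi.smul_apply, nsmul_eq_mul]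
  simp only [Pi.neg_apply, hsm]
  simp only [nsmul_eq_mul]
  push_cast at this ⊢
  rw [mul_pow, mul_pow, inv_pow]
  field_simp
  ring

open Filter Topology in
theorem AC_r {d : ℕ} {V0 : (Fin d → ℝ) → ℝ} {r : ℝ} (S : Setup V0 r) (l κ : Fin d → ℤ)
    (ρ : ℝ) (h0 : 0 ≤ ρ) (h1 : ρ < 1) :
    AC V0 r (fun q i => EE l q * ((l i : ℂ) * (-Complex.log (1 - ρ * EE κ q)
        - -Complex.log (1 - ρ * (EE κ q)⁻¹)) +
        (κ i : ℂ) * ((ρ * EE κ q) * (1 - ρ * EE κ q)⁻¹ + (ρ * (EE κ q)⁻¹) * (1 - ρ * (EE κ q)⁻¹)⁻¹))) := by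
  refine AC.limit S (fun n => AC.sum S (Finset.range n) _ fun m _ => AC_term S l κ ρ m) ?_ ?_ ?_
  · have := (EE_cont l).measurable
    have := (EE_cont κ).measurable
    refine measurable_pi_iff.2 fun i => ?_
    fun_prop
  · intro k q; simp only [EE_per]
  · refine Eventually.of_forall fun q => ?_
    rw [tendsto_pi_nhds]
    intro i
    simp only [Finset.sum_apply]
    have hz : ‖(ρ : ℂ) * EE κ q‖ < 1 := by
      rw [norm_mul, EE_norm, mul_one, Complex.norm_of_nonneg h0]; exact h1
    have hz' : ‖(ρ : ℂ) * (EE κ q)⁻¹‖ < 1 := by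
      rw [norm_mul, norm_inv, EE_norm, inv_one, mul_one, Complex.norm_of_nonneg h0]; exact h1
    have hlog : ∀ z : ℂ, ‖z‖ < 1 → HasSum (fun m : ℕ => z ^ (m + 1) / ((m + 1 : ℕ) : ℂ)) (-Complex.log (1 - z)) := by
      intro z hz
      have := (hasSum_nat_add_iff' 1).2 (Complex.hasSum_taylorSeries_neg_log hz)
      simpa using this
    have hgeo : ∀ z : ℂ, ‖z‖ < 1 → HasSum (fun m : ℕ => z ^ (m + 1)) (z * (1 - z)⁻¹) := by
      intro z hz
      have := (hasSum_geometric_of_norm_lt_one hz).mul_left z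
      simpa [pow_succ'] using this
    exact ((((hlog _ hz).sub (hlog _ hz')).mul_left (l i : ℂ)).add
      (((hgeo _ hz).add (hgeo _ hz')).mul_left (κ i : ℂ))).mul_left (EE l q) |>.tendsto_sum_nat

open MeasureTheory Real

theorem EE_single {d : ℕ} (j : Fin d) (n : ℕ) (q : Fin d → ℝ) :
    EE (n • Pi.single j 1) q = Complex.exp ((n * q j : ℝ) * Complex.I) := by
  unfold EE dotZ
  congr 3
  rw [Finset.sum_eq_single j]
  · simp
  · intro b _ hb; simp [hb]
  · simp

theorem ae_EE_ne {d : ℕ} (j : Fin d) (n : ℕ) (hn : n ≠ 0) :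
    ∀ᵐ q : Fin d → ℝ, EE (n • Pi.single j 1) q ≠ 1 := by
  have h : ∀ᵐ q : Fin d → ℝ, ∀ m : ℤ, q j ≠ m * (2 * π) / n := by
    rw [ae_all_iff]
    intro m
    have := Measure.pi_hyperplane (fun _ : Fin d => (volume : Measure ℝ)) j (m * (2 * π) / n)
    rw [ae_iff]
    simpa [volume_pi] using this
  filter_upwards [h] with q hq hE
  rw [EE_single, Complex.exp_eq_one_iff] at hE
  obtain ⟨m, hm⟩ := hE
  apply hq m
  have h2 : ((n * q j : ℝ) : ℂ) = ((m * (2 * π) : ℝ) : ℂ) := by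
    have := Complex.I_ne_zero
    have h3 : ((n * q j : ℝ) : ℂ) * Complex.I = ((m * (2 * π) : ℝ) : ℂ) * Complex.I := by
      rw [hm]; push_cast; ring
    exact mul_right_cancel₀ this h3
  have h3 : n * q j = m * (2 * π) := by exact_mod_cast h2
  have : (n : ℝ) ≠ 0 := by exact_mod_cast hn
  field_simp
  linarith

open Filter Topology in
theorem AC_one {d : ℕ} {V0 : (Fin d → ℝ) → ℝ} {r : ℝ} (S : Setup V0 r) (l : Fin d → ℤ) (j : Fin d)
    (n : ℕ) (hn : n ≠ 0) (κ : Fin d → ℤ) (hκ : κ = n • Pi.single j 1) :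
    AC V0 r (fun q i => EE l q * ((l i : ℂ) * (-Complex.log (1 - EE κ q)
        - -Complex.log (1 - (EE κ q)⁻¹)) + (κ i : ℂ) * (-1))) := by
  have hs0 : ∀ n : ℕ, 0 ≤ 1 - ((n : ℝ) + 1)⁻¹ := fun n => sub_nonneg.2 (s_le n)
  have hs1 : ∀ n : ℕ, 1 - ((n : ℝ) + 1)⁻¹ < 1 := fun n => by linarith [s_pos n]
  refine AC.limit S (fun n => AC_r S l κ (1 - ((n : ℝ) + 1)⁻¹) (hs0 n) (hs1 n)) ?_ ?_ ?_
  · have := (EE_cont l).measurable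
    have := (EE_cont κ).measurable
    refine measurable_pi_iff.2 fun i => ?_
    fun_prop
  · intro k q; simp only [EE_per]
  · have hae := ae_EE_ne j n hn
    rw [← hκ] at hae
    filter_upwards [hae] with q hq
    rw [tendsto_pi_nhds]
    intro i
    have hρ : Tendsto (fun n : ℕ => (((1 - ((n : ℝ) + 1)⁻¹ : ℝ)) : ℂ)) atTop (𝓝 1) := by
      have h1 : Tendsto (fun n : ℕ => 1 - ((n : ℝ) + 1)⁻¹) atTop (𝓝 (1 - 0)) := tendsto_s.const_sub 1
      rw [sub_zero] at h1
      exact_mod_cast (Complex.continuous_ofReal.tendsto 1).comp h1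
    have key : ∀ z : ℂ, ‖z‖ = 1 → z ≠ 1 → Tendsto (fun n : ℕ => -Complex.log (1 - (((1 - ((n : ℝ) + 1)⁻¹ : ℝ)) : ℂ) * z))
        atTop (𝓝 (-Complex.log (1 - z))) ∧
        Tendsto (fun n : ℕ => ((((1 - ((n : ℝ) + 1)⁻¹ : ℝ)) : ℂ) * z) * (1 - (((1 - ((n : ℝ) + 1)⁻¹ : ℝ)) : ℂ) * z)⁻¹)
        atTop (𝓝 (z * (1 - z)⁻¹)) := by
      intro z hz hz1
      have ht : Tendsto (fun n : ℕ => (((1 - ((n : ℝ) + 1)⁻¹ : ℝ)) : ℂ) * z) atTop (𝓝 z) := by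
        simpa using hρ.mul_const z
      have hre : z.re < 1 := by
        refine lt_of_le_of_ne ((Complex.re_le_norm z).trans hz.le) fun h => hz1 ?_
        have h2 := Complex.normSq_apply z
        rw [Complex.normSq_eq_norm_sq, hz, h] at h2
        have him : z.im = 0 := by nlinarith
        exact Complex.ext h him
      have hne : (1 - z) ≠ 0 := sub_ne_zero.2 hz1.symm
      refine ⟨((Filter.Tendsto.clog (ht.const_sub 1) ?_)).neg, ht.mul ((ht.const_sub 1).inv₀ hne)⟩
      left
      simp [hre]
    have hne0 : EE κ q ≠ 0 := norm_ne_zero_iff.1 (by rw [EE_norm]; exact one_ne_zero)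
    have hinv : (EE κ q)⁻¹ ≠ 1 := by simpa using hq
    obtain ⟨a1, a2⟩ := key _ (EE_norm κ q) hq
    obtain ⟨b1, b2⟩ := key (EE κ q)⁻¹ (by rw [norm_inv, EE_norm, inv_one]) hinv
    have hval : EE κ q * (1 - EE κ q)⁻¹ + (EE κ q)⁻¹ * (1 - (EE κ q)⁻¹)⁻¹ = -1 := by
      have h1 : 1 - EE κ q ≠ 0 := sub_ne_zero.2 hq.symm
      have h2 : EE κ q - 1 ≠ 0 := sub_ne_zero.2 hq
      have h3 : (EE κ q)⁻¹ * (1 - (EE κ q)⁻¹)⁻¹ = (EE κ q - 1)⁻¹ := by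
        rw [← mul_inv, mul_sub, mul_one, mul_inv_cancel₀ hne0]
      rw [h3]
      field_simp
      ring
    rw [← hval]
    exact (((a1.sub b1).const_mul _).add ((a2.add b2).const_mul _)).const_mul _

open Filter Topology in
theorem AC_ej {d : ℕ} {V0 : (Fin d → ℝ) → ℝ} {r : ℝ} (S : Setup V0 r) (l : Fin d → ℤ) (j : Fin d) :
    AC V0 r (fun q => EE l q • (Pi.single j 1 : Fin d → ℂ)) := by
  refine AC.limit S (fun n => (AC_one S l j (n + 1) (Nat.succ_ne_zero n) _ rfl).smul
    (-((((n : ℝ) + 1)⁻¹ : ℝ) : ℂ))) ?_ ?_ ?_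
  · exact (EE_cont l).measurable.smul_const _
  · intro k q; simp only [EE_per]
  · refine Eventually.of_forall fun q => ?_
    rw [tendsto_pi_nhds]
    intro i
    refine tendsto_of_norm_le (b := fun n : ℕ => (‖(l i : ℂ)‖ * (2 * π)) * ((n : ℝ) + 1)⁻¹) tendsto_const_nhds
      (by simpa using tendsto_s.const_mul (‖(l i : ℂ)‖ * (2 * π))) fun n => ?_
    set z := EE ((n + 1) • Pi.single j 1) q with hz
    have hzn : ‖z‖ = 1 := EE_norm _ q
    have hc : (((n + 1) • (Pi.single j 1 : Fin d → ℤ)) i : ℂ) = ((n : ℂ) + 1) * (Pi.single j 1 : Fin d → ℂ) i := by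
      rw [Pi.smul_apply, nsmul_eq_mul]
      by_cases h : i = j
      · subst h; simp
      · simp [h]
    have e : ((-((((n : ℝ) + 1)⁻¹ : ℝ) : ℂ)) • fun i => EE l q * ((l i : ℂ) * (-Complex.log (1 - z)
        - -Complex.log (1 - z⁻¹)) + (((n + 1) • (Pi.single j 1 : Fin d → ℤ)) i : ℂ) * (-1))) i -
        (EE l q • (Pi.single j 1 : Fin d → ℂ)) i =
        ((((n : ℝ) + 1)⁻¹ : ℝ) : ℂ) * (EE l q * ((l i : ℂ) * (Complex.log (1 - z) - Complex.log (1 - z⁻¹)))) := by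
      simp only [Pi.smul_apply, smul_eq_mul]
      rw [Pi.smul_apply] at hc
      rw [hc]
      have : (n : ℂ) + 1 ≠ 0 := by exact_mod_cast Nat.succ_ne_zero n
      push_cast
      field_simp
      ring
    rw [e, norm_mul, norm_mul, norm_mul, EE_norm, one_mul, mul_comm, Complex.norm_of_nonneg (s_pos n).le]
    refine mul_le_mul_of_nonneg_right (mul_le_mul_of_nonneg_left ?_ (norm_nonneg _)) (s_pos n).le
    have h1 : ‖1 - z⁻¹‖ = ‖1 - z‖ := by
      rw [Complex.inv_eq_conj hzn, ← Complex.norm_conj]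
      simp
    have h2 : Complex.log (1 - z) - Complex.log (1 - z⁻¹) =
        (((1 - z).arg - (1 - z⁻¹).arg : ℝ) : ℂ) * Complex.I := by
      unfold Complex.log
      rw [h1]; push_cast; ring
    rw [h2, norm_mul, Complex.norm_I, mul_one, Complex.norm_real]
    refine (norm_sub_le _ _).trans ?_
    have := Complex.abs_arg_le_pi (1 - z)
    have := Complex.abs_arg_le_pi (1 - z⁻¹)
    simp only [Real.norm_eq_abs]
    linarith

open MeasureTheory Real

/-- projection to the unit torus -/
noncomputable def tor {d : ℕ} (q : Fin d → ℝ) : UnitAddTorus (Fin d) :=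
  fun i => ((q i / (2 * π) : ℝ) : UnitAddCircle)

theorem tor_cont {d : ℕ} : Continuous (tor (d := d)) := by
  refine continuous_pi fun i => ?_
  exact (AddCircle.continuous_mk' 1).comp ((continuous_apply i).div_const _)

theorem tor_sh {d : ℕ} (k : Fin d → ℤ) (q : Fin d → ℝ) : tor (sh k q) = tor q := by
  funext i
  have hp : (2 * π) ≠ 0 := by positivity
  have : (q i + 2 * π * (k i)) / (2 * π) = q i / (2 * π) + (k i : ℝ) := by
    field_simp
  simp only [tor, sh, this]
  rw [AddCircle.coe_add]
  have h : (((k i : ℤ) : ℝ) : UnitAddCircle) = 0 := by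
    rw [AddCircle.coe_eq_zero_iff]
    exact ⟨k i, by simp⟩
  rw [h, add_zero]

/-- section of the projection -/
noncomputable def torInv {d : ℕ} (x : UnitAddTorus (Fin d)) : Fin d → ℝ :=
  fun i => 2 * π * ((AddCircle.measurableEquivIco 1 0 (x i) : Set.Ico (0:ℝ) (0 + 1)) : ℝ)

theorem torInv_meas {d : ℕ} : Measurable (torInv (d := d)) := by
  refine measurable_pi_iff.2 fun i => ?_
  exact (measurable_subtype_coe.comp ((AddCircle.measurableEquivIco 1 0).measurable.comp
    (measurable_pi_apply i))).const_mul _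

theorem torInv_tor {d : ℕ} (q : Fin d → ℝ) : ∃ k, torInv (tor q) = sh k q := by
  refine ⟨fun i => -⌊q i / (2 * π)⌋, funext fun i => ?_⟩
  have hp : (2 * π) ≠ 0 := by positivity
  have h : ((AddCircle.measurableEquivIco 1 0 ((q i / (2 * π) : ℝ) : UnitAddCircle) : Set.Ico (0:ℝ) (0 + 1)) : ℝ)
      = Int.fract (q i / (2 * π) / 1) * 1 := AddCircle.coe_equivIco_mk_apply 1 (q i / (2 * π))
  simp only [torInv, tor, h, sh]
  rw [div_one, mul_one, Int.fract]
  push_cast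
  field_simp
  ring

theorem mFourier_tor {d : ℕ} (n : Fin d → ℤ) (q : Fin d → ℝ) :
    UnitAddTorus.mFourier n (tor q) = EE n q := by
  simp only [UnitAddTorus.mFourier, ContinuousMap.coe_mk, tor, fourier_coe_apply, EE, dotZ]
  rw [← Complex.exp_sum]
  congr 1
  push_cast
  rw [Finset.sum_mul]
  refine Finset.sum_congr rfl fun i _ => ?_
  have : (π : ℂ) ≠ 0 := by exact_mod_cast pi_ne_zero
  field_simp

open Filter Topology in
theorem AC_cont {d : ℕ} {V0 : (Fin d → ℝ) → ℝ} {r : ℝ} (S : Setup V0 r) (j : Fin d)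
    (f : C(UnitAddTorus (Fin d), ℂ)) :
    AC V0 r (fun q => f (tor q) • (Pi.single j 1 : Fin d → ℂ)) := by
  have hmeas : ∀ f : C(UnitAddTorus (Fin d), ℂ),
      Measurable (fun q : Fin d → ℝ => f (tor q) • (Pi.single j 1 : Fin d → ℂ)) := fun f =>
    (f.continuous.comp tor_cont).measurable.smul_const _
  let P : Submodule ℂ C(UnitAddTorus (Fin d), ℂ) :=
    { carrier := {f | AC V0 r (fun q => f (tor q) • (Pi.single j 1 : Fin d → ℂ))}
      zero_mem' := by
        have := AC.zero (r := r) S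
        simpa using this
      add_mem' := by
        intro f g hf hg
        have := AC.add S hf hg
        simpa [add_smul] using this
      smul_mem' := by
        intro c f hf
        have := AC.smul hf c
        simpa [smul_smul] using this }
  have hcl : IsClosed (P : Set C(UnitAddTorus (Fin d), ℂ)) := by
    rw [← isSeqClosed_iff_isClosed]
    intro u f hu hf
    refine AC.limit S hu (hmeas f) (fun k q => by simp only [tor_sh]) ?_
    refine Eventually.of_forall fun q => ?_
    have := ((continuous_eval_const (F := C(UnitAddTorus (Fin d), ℂ)) (tor q)).tendsto f).comp hf
    exact this.smul_const _
  have hsp : (Submodule.span ℂ (Set.range (UnitAddTorus.mFourier (d := Fin d)))).topologicalClosure ≤ P := by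
    apply Submodule.topologicalClosure_minimal _ _ hcl
    rw [Submodule.span_le]
    rintro _ ⟨n, rfl⟩
    have := AC_ej S n j
    show AC V0 r _
    simpa only [mFourier_tor] using this
  rw [UnitAddTorus.span_mFourier_closure_eq_top] at hsp
  exact hsp (Submodule.mem_top (x := f))

open Filter Topology in
theorem AC_bdd {d : ℕ} {V0 : (Fin d → ℝ) → ℝ} {r : ℝ} (S : Setup V0 r) (j : Fin d)
    (f : (Fin d → ℝ) → ℂ) (hm : Measurable f) (hp : ∀ k q, f (sh k q) = f q) (C : ℝ)
    (hC : ∀ q, ‖f q‖ ≤ C) :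
    AC V0 r (fun q => f q • (Pi.single j 1 : Fin d → ℂ)) := by
  let μ : Measure (UnitAddTorus (Fin d)) := (Measure.toFinite (volume : Measure (Fin d → ℝ))).map tor
  have htm : Measurable (tor (d := d)) := tor_cont.measurable
  have : IsFiniteMeasure μ := inferInstance
  let F : UnitAddTorus (Fin d) → ℂ := fun x => f (torInv x)
  have hFm : Measurable F := hm.comp torInv_meas
  have hF : MemLp F 1 μ := MemLp.of_bound hFm.aestronglyMeasurable C (Eventually.of_forall fun x => hC _)
  choose g hg hg2 using fun n : ℕ => hF.exists_boundedContinuous_eLpNorm_sub_le ENNReal.one_ne_top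
    (ε := ENNReal.ofReal ((n : ℝ) + 1)⁻¹) (by simpa using s_pos n)
  have hlim : TendstoInMeasure μ (fun n => (g n : UnitAddTorus (Fin d) → ℂ)) atTop F := by
    refine tendstoInMeasure_of_tendsto_eLpNorm one_ne_zero (fun n => (hg2 n).1) hF.1 ?_
    have h0 : Tendsto (fun n : ℕ => ENNReal.ofReal ((n : ℝ) + 1)⁻¹) atTop (𝓝 0) := by
      simpa using ENNReal.tendsto_ofReal tendsto_s
    refine tendsto_of_tendsto_of_tendsto_of_le_of_le tendsto_const_nhds h0 (fun _ => zero_le) fun n => ?_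
    rw [eLpNorm_sub_comm]; exact hg n
  obtain ⟨ns, -, hns⟩ := hlim.exists_seq_tendsto_ae
  have hae := ae_of_ae_map htm.aemeasurable hns
  rw [ae_toFinite] at hae
  refine AC.limit S (fun n => AC_cont S j (g (ns n)).toContinuousMap) (hm.smul_const _)
    (fun k q => by rw [hp]) ?_
  filter_upwards [hae] with q hq
  have e : F (tor q) = f q := by
    obtain ⟨k, hk⟩ := torInv_tor q
    simp only [F, hk, hp]
  rw [e] at hq
  exact hq.smul_const _

open Filter Topology in
/-- all measurable periodic vertical shears are attainable -/
theorem VS_all {d : ℕ} {V0 : (Fin d → ℝ) → ℝ} {r : ℝ} (S : Setup V0 r)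
    (w : (Fin d → ℝ) → (Fin d → ℝ)) (hm : Measurable w) (hp : ∀ k q, w (sh k q) = w q) :
    DR V0 r 0 (VS w) := by
  have hbd : ∀ (w : (Fin d → ℝ) → (Fin d → ℝ)) (hm : Measurable w) (hp : ∀ k q, w (sh k q) = w q)
      (C : ℝ) (hC : ∀ q, ‖w q‖ ≤ C), DR V0 r 0 (VS w) := by
    intro w hm hp C hC
    have := (AC.sum S Finset.univ _ fun j _ => AC_bdd S j (fun q => (w q j : ℂ))
      (Complex.measurable_ofReal.comp ((measurable_pi_apply j).comp hm)) (fun k q => by simp only [hp]) C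
      (fun q => by
        rw [Complex.norm_real]
        exact (norm_le_pi_norm (w q) j).trans (hC q))).dr 1
    convert this using 2
    funext q i
    rw [Finset.sum_apply, one_mul, Finset.sum_eq_single i]
    · simp
    · intro b _ hb; simp [hb.symm]
    · simp
  have hS : ∀ n : ℕ, MeasurableSet {q | ‖w q‖ ≤ n} := fun n => measurableSet_le hm.norm measurable_const
  classical
  refine VS_limit S (fun n q => if ‖w q‖ ≤ n then w q else 0) w
    (fun n => Measurable.ite (hS n) hm measurable_const) hm (fun n k q => by simp only [hp]) hp ?_
    (fun n => hbd _ (Measurable.ite (hS n) hm measurable_const) (fun k q => by simp only [hp]) n ?_)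
  · refine Eventually.of_forall fun q => ?_
    obtain ⟨N, hN⟩ := exists_nat_ge ‖w q‖
    refine tendsto_const_nhds.congr' ?_
    filter_upwards [eventually_ge_atTop N] with n hn
    rw [if_pos]
    exact hN.trans (by exact_mod_cast hn)
  · intro q
    split_ifs with h
    · exact h
    · simp

open MeasureTheory Real

theorem round_of_near {x : ℝ} {R : ℤ} (h : |x - R| < 1 / 2) : round x = R := by
  have h1 : x = (x - R) + R := by ring
  rw [h1, round_add_intCast]
  have : round (x - R) = 0 := by
    rw [round_eq_zero_iff]
    rw [abs_lt] at h
    constructor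
    · linarith [h.1]
    · linarith [h.2]
  rw [this, zero_add]

/-- centred remainder -/
noncomputable def yy {d : ℕ} (h : ℝ) (q : Fin d → ℝ) : Fin d → ℝ :=
  fun i => q i - 2 * h * (round (q i / (2 * h)) : ℝ)

/-- lattice vectors -/
def IsLat {d : ℕ} (h : ℝ) (c : Fin d → ℝ) : Prop := ∃ m : Fin d → ℤ, c = fun i => 2 * h * (m i : ℝ)

theorem IsLat.add {d : ℕ} {h : ℝ} {a b : Fin d → ℝ} (ha : IsLat h a) (hb : IsLat h b) : IsLat h (a + b) := by
  obtain ⟨m, rfl⟩ := ha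
  obtain ⟨n, rfl⟩ := hb
  exact ⟨m + n, by funext i; simp; ring⟩

theorem yy_eq {d : ℕ} {h : ℝ} (hh : 0 < h) {c a : Fin d → ℝ} (hc : IsLat h c) (ha : ‖a‖ < h)
    (q : Fin d → ℝ) (hq : q = c + a) : yy h q = a := by
  obtain ⟨m, rfl⟩ := hc
  subst hq
  funext i
  have hai : |a i| < h := (norm_le_pi_norm a i).trans_lt ha
  have : round (((fun i => 2 * h * (m i : ℝ)) + a) i / (2 * h)) = m i := by
    apply round_of_near
    have e : ((fun i => 2 * h * (m i : ℝ)) + a) i / (2 * h) - m i = a i / (2 * h) := by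
      simp only [Pi.add_apply]; field_simp; ring
    rw [e, abs_div, abs_of_pos (by linarith : 0 < 2 * h), div_lt_iff₀ (by linarith)]
    linarith
  simp only [yy, this]
  simp

theorem yy_lat {d : ℕ} (h : ℝ) (q : Fin d → ℝ) : IsLat h (q - yy h q) :=
  ⟨fun i => round (q i / (2 * h)), by funext i; simp [yy]⟩

theorem measurable_round' : Measurable (fun x : ℝ => (round x : ℝ)) := by
  have : (fun x : ℝ => (round x : ℝ)) = fun x => ((⌊x + 1 / 2⌋ : ℤ) : ℝ) := by
    funext x; rw [round_eq]
  rw [this]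
  exact (measurable_from_top (f := fun n : ℤ => (n : ℝ))).comp
    (Int.measurable_floor.comp (measurable_id.add_const _))

theorem yy_meas {d : ℕ} (h : ℝ) : Measurable (yy (d := d) h) := by
  refine measurable_pi_iff.2 fun i => ?_
  exact (measurable_pi_apply i).sub
    ((measurable_round'.comp ((measurable_pi_apply i).div_const _)).const_mul _)

theorem yy_per {d : ℕ} {h : ℝ} (M : ℕ) (hM : 2 * h * M = 2 * π) (k : Fin d → ℤ) (q : Fin d → ℝ) :
    yy h (sh k q) = yy h q := by
  have hh : 2 * h ≠ 0 := by
    intro h0; rw [h0, zero_mul] at hM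
    have := pi_pos; linarith
  have hh0 : h ≠ 0 := by
    intro h0; apply hh; rw [h0, mul_zero]
  funext i
  have e : (q i + 2 * π * (k i)) / (2 * h) = q i / (2 * h) + ((M * k i : ℤ) : ℝ) := by
    rw [← hM]; push_cast; field_simp
  simp only [yy, sh, e, round_add_intCast]
  rw [← hM]
  push_cast
  ring

theorem ae_round {d : ℕ} (i : Fin d) (s : ℝ) (hs : s ≠ 0) :
    ∀ᵐ q : Fin d → ℝ, |q i / s - round (q i / s)| < 1 / 2 := by
  have h : ∀ (t : ℝ), ∀ᵐ q : Fin d → ℝ, ∀ m : ℤ, q i ≠ s * (m + t) := by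
    intro t
    rw [ae_all_iff]
    intro m
    have := Measure.pi_hyperplane (fun _ : Fin d => (volume : Measure ℝ)) i (s * (m + t))
    rw [ae_iff]
    simpa [volume_pi] using this
  filter_upwards [h (1 / 2), h (-(1 / 2))] with q h1 h2
  refine lt_of_le_of_ne (abs_sub_round _) fun he => ?_
  rcases eq_or_eq_neg_of_abs_eq he with h3 | h3
  · apply h1 (round (q i / s))
    rw [← h3]; field_simp; ring
  · apply h2 (round (q i / s))
    rw [← h3]; field_simp; ring

theorem ae_yy {d : ℕ} {h : ℝ} (hh : 0 < h) : ∀ᵐ q : Fin d → ℝ, ‖yy h q‖ < h := by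
  have := ae_all_iff.2 fun i : Fin d => ae_round i (2 * h) (by linarith)
  filter_upwards [this] with q hq
  rw [pi_norm_lt_iff hh]
  intro i
  have e : yy h q i = (2 * h) * (q i / (2 * h) - round (q i / (2 * h))) := by
    simp only [yy]; field_simp
  rw [e, Real.norm_eq_abs, abs_mul, abs_of_pos (by linarith : 0 < 2 * h)]
  nlinarith [hq i]

/-- exchange map -/
noncomputable def SS {d : ℕ} (h : ℝ) (F : ℝ → Phase d → Phase d) (δ : ℝ) : Phase d → Phase d :=
  VS (fun q => (-δ⁻¹) • yy h q) ∘ (F δ ∘ VS (fun q => (-δ⁻¹) • yy h q))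

/-- approximate location -/
def Near {d : ℕ} (δ K : ℝ) (c A B : Fin d → ℝ) (x : Phase d) : Prop :=
  ‖x.1 - c - A‖ ≤ K * δ ^ 2 ∧ ‖x.2 - B‖ ≤ K * δ

theorem SS_near {d : ℕ} {V0 : (Fin d → ℝ) → ℝ} {r A0 C h δ K : ℝ} {F : ℝ → Phase d → Phase d}
    (hF : FreeFlow V0 r F A0 C) (hh : 0 < h) (hδ : 0 < δ) {c A B : Fin d → ℝ} {x : Phase d}
    (hc : IsLat h c) (hx : Near δ K c A B x) (h1 : ‖A‖ + K * δ ^ 2 < h)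
    (h2 : ‖δ • B‖ + (K + C) * δ ^ 2 < h) :
    Near δ (K + 2 * C) c (δ • B) (-(δ⁻¹ • A)) (SS h F δ x) := by
  have hC := hF.hC
  have hδ' := hδ.ne'
  have hy : yy h x.1 = x.1 - c := by
    refine yy_eq hh hc ?_ _ (by abel)
    have : x.1 - c = A + (x.1 - c - A) := by abel
    rw [this]
    exact (norm_add_le _ _).trans_lt (by linarith [hx.1])
  set z : Phase d := VS (fun q => (-δ⁻¹) • yy h q) x with hz
  have z1 : z.1 = x.1 := rfl
  have z2 : z.2 = x.2 - δ⁻¹ • (x.1 - c) := by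
    simp only [hz, VS, hy, neg_smul, sub_eq_add_neg]
  have e1 := hF.est1 z δ hδ.le
  have e2 := hF.est2 z δ hδ.le
  set y := F δ z with hy0
  have E1 : ‖y.1 - c - δ • x.2‖ ≤ C * δ ^ 2 := by
    have : y.1 - c - δ • x.2 = y.1 - z.1 - δ • z.2 := by
      rw [z1, z2, smul_sub, smul_smul, mul_inv_cancel₀ hδ', one_smul]; abel
    rw [this]; calc _ ≤ _ := e1
      _ = _ := by ring
  have E1' : ‖y.1 - c - δ • B‖ ≤ (K + C) * δ ^ 2 := by
    have : y.1 - c - δ • B = (y.1 - c - δ • x.2) + δ • (x.2 - B) := by rw [smul_sub]; abel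
    rw [this]
    refine (norm_add_le _ _).trans ?_
    rw [norm_smul, Real.norm_of_nonneg hδ.le]
    nlinarith [hx.2, mul_le_mul_of_nonneg_left hx.2 hδ.le]
  have hyy : yy h y.1 = y.1 - c := by
    refine yy_eq hh hc ?_ _ (by abel)
    have : y.1 - c = δ • B + (y.1 - c - δ • B) := by abel
    rw [this]
    exact (norm_add_le _ _).trans_lt (by linarith)
  have hS : SS h F δ x = (y.1, y.2 - δ⁻¹ • (y.1 - c)) := by
    show VS (fun q => (-δ⁻¹) • yy h q) y = _
    simp only [VS, hyy, neg_smul, sub_eq_add_neg]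
  rw [hS]
  constructor
  · refine E1'.trans ?_
    nlinarith [sq_nonneg δ]
  · have : (y.2 - δ⁻¹ • (y.1 - c)) - -(δ⁻¹ • A) =
        (y.2 - z.2) - δ⁻¹ • (y.1 - c - δ • x.2) - δ⁻¹ • (x.1 - c - A) := by
      rw [z2, smul_sub δ⁻¹ (y.1 - c), smul_smul, inv_mul_cancel₀ hδ', one_smul,
        smul_sub δ⁻¹ (x.1 - c) A]; abel
    simp only [this]
    have n1 : ‖δ⁻¹ • (y.1 - c - δ • x.2)‖ ≤ C * δ := by
      rw [norm_smul, norm_inv, Real.norm_of_nonneg hδ.le, inv_mul_le_iff₀ hδ]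
      calc _ ≤ _ := E1
        _ = _ := by ring
    have n2 : ‖δ⁻¹ • (x.1 - c - A)‖ ≤ K * δ := by
      rw [norm_smul, norm_inv, Real.norm_of_nonneg hδ.le, inv_mul_le_iff₀ hδ]
      calc _ ≤ _ := hx.1
        _ = _ := by ring
    calc _ ≤ ‖y.2 - z.2‖ + ‖δ⁻¹ • (y.1 - c - δ • x.2)‖ + ‖δ⁻¹ • (x.1 - c - A)‖ :=
          (norm_sub_le _ _).trans (add_le_add_left (norm_sub_le _ _) _)
      _ ≤ C * δ + C * δ + K * δ := by linarith
      _ = _ := by ring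

/-- translation map -/
noncomputable def XX {d : ℕ} (h : ℝ) (v : (Fin d → ℝ) → (Fin d → ℝ)) (F : ℝ → Phase d → Phase d)
    (δ : ℝ) : Phase d → Phase d :=
  VS (fun q => (-(δ ^ 3)⁻¹) • v (δ⁻¹ • yy h q)) ∘ (F (δ ^ 3) ∘ VS (fun q => (δ ^ 3)⁻¹ • v (δ⁻¹ • yy h q)))

theorem XX_near {d : ℕ} {V0 : (Fin d → ℝ) → ℝ} {r A0 C h δ K η : ℝ} {F : ℝ → Phase d → Phase d}
    (hF : FreeFlow V0 r F A0 C) (hh : 0 < h) (hδ : 0 < δ) (hδ1 : δ ≤ 1) (hK : 0 ≤ K)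
    {v : (Fin d → ℝ) → (Fin d → ℝ)}
    (hv : ∀ p, IsLat h (v p)) {c A p : Fin d → ℝ} {x : Phase d}
    (hc : IsLat h c) (hx : Near δ K c (δ • p) (-(δ⁻¹ • A)) x) (hA : ‖A‖ < h)
    (h1 : ‖δ • p‖ + (2 * K + h + C) * δ ^ 2 < h)
    (hη : ∀ p', ‖p' - p‖ ≤ η → v p' = v p) (h2 : (2 * K + h + C) * δ ≤ η) :
    Near δ (2 * K + h + C) (c + v p) (δ • p) (-(δ⁻¹ • A)) (XX h v F δ x) := by
  have hC := hF.hC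
  have hδ' := hδ.ne'
  have hd3 : 0 < δ ^ 3 := by positivity
  have near_v : ∀ (a : Fin d → ℝ), ‖a - δ • p‖ ≤ (2 * K + h + C) * δ ^ 2 → v (δ⁻¹ • a) = v p := by
    intro a ha
    apply hη
    refine le_trans ?_ h2
    have : δ⁻¹ • a - p = δ⁻¹ • (a - δ • p) := by
      rw [smul_sub, smul_smul, inv_mul_cancel₀ hδ', one_smul]
    rw [this, norm_smul, norm_inv, Real.norm_of_nonneg hδ.le, inv_mul_le_iff₀ hδ]
    calc _ ≤ _ := ha
      _ = _ := by ring
  have near_y : ∀ (c' q a : Fin d → ℝ), IsLat h c' → q = c' + a → ‖a - δ • p‖ ≤ (2 * K + h + C) * δ ^ 2 →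
      v (δ⁻¹ • yy h q) = v p := by
    intro c' q a hc' hq ha
    rw [yy_eq hh hc' ?_ q hq]
    · exact near_v a ha
    · have : a = δ • p + (a - δ • p) := by abel
      rw [this]
      exact (norm_add_le _ _).trans_lt (by linarith)
  have hW : v (δ⁻¹ • yy h x.1) = v p := by
    refine near_y c x.1 (x.1 - c) hc (by abel) (hx.1.trans ?_)
    have := sq_nonneg δ
    gcongr
    linarith
  set z : Phase d := VS (fun q => (δ ^ 3)⁻¹ • v (δ⁻¹ • yy h q)) x with hz
  have z1 : z.1 = x.1 := rfl
  have z2 : z.2 = x.2 + (δ ^ 3)⁻¹ • v p := by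
    simp only [hz, VS, hW]
  have e1 := hF.est1 z (δ ^ 3) hd3.le
  have e2 := hF.est2 z (δ ^ 3) hd3.le
  set y := F (δ ^ 3) z with hy0
  have hP : ‖δ ^ 3 • x.2‖ ≤ (h + K) * δ ^ 2 := by
    have : δ ^ 3 • x.2 = δ ^ 3 • (x.2 - -(δ⁻¹ • A)) - δ ^ 2 • A := by
      rw [smul_sub, smul_neg, smul_smul]
      have : δ ^ 3 * δ⁻¹ = δ ^ 2 := by field_simp
      rw [this]; abel
    rw [this]
    refine (norm_sub_le _ _).trans ?_
    rw [norm_smul, norm_smul, Real.norm_of_nonneg hd3.le, Real.norm_of_nonneg (sq_nonneg δ)]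
    have a1 : δ ^ 3 * ‖x.2 - -(δ⁻¹ • A)‖ ≤ δ ^ 3 * (K * δ) := mul_le_mul_of_nonneg_left hx.2 hd3.le
    have a2 : δ ^ 2 * ‖A‖ ≤ δ ^ 2 * h := mul_le_mul_of_nonneg_left hA.le (sq_nonneg δ)
    have a3 : δ ^ 3 * (K * δ) ≤ K * δ ^ 2 := by
      have : δ ^ 2 ≤ 1 := pow_le_one₀ hδ.le hδ1
      have : 0 ≤ K * δ ^ 2 := by positivity
      nlinarith
    linarith
  have E1 : ‖y.1 - (c + v p) - δ • p‖ ≤ (2 * K + h + C) * δ ^ 2 := by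
    have : y.1 - (c + v p) - δ • p = (y.1 - z.1 - δ ^ 3 • z.2) + (x.1 - c - δ • p) + δ ^ 3 • x.2 := by
      rw [z1, z2, smul_add, smul_smul, mul_inv_cancel₀ hd3.ne', one_smul]; abel
    rw [this]
    refine (norm_add₃_le).trans ?_
    have a1 : C * δ ^ 3 * δ ^ 3 ≤ C * δ ^ 2 := by
      have : δ ^ 4 ≤ 1 := pow_le_one₀ hδ.le hδ1
      have : 0 ≤ C * δ ^ 2 := by positivity
      nlinarith
    linarith [hx.1]
  have hW' : v (δ⁻¹ • yy h y.1) = v p :=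
    near_y (c + v p) y.1 (y.1 - (c + v p)) (hc.add (hv p)) (by abel) E1
  have hS : XX h v F δ x = (y.1, y.2 - (δ ^ 3)⁻¹ • v p) := by
    show VS (fun q => (-(δ ^ 3)⁻¹) • v (δ⁻¹ • yy h q)) y = _
    simp only [VS, hW', neg_smul, sub_eq_add_neg]
  rw [hS]
  refine ⟨E1, ?_⟩
  have : (y.2 - (δ ^ 3)⁻¹ • v p) - -(δ⁻¹ • A) = (y.2 - z.2) + (x.2 - -(δ⁻¹ • A)) := by
    rw [z2]; abel
  simp only [this]
  refine (norm_add_le _ _).trans ?_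
  have a1 : C * δ ^ 3 ≤ C * δ := by
    have : δ ^ 2 ≤ 1 := pow_le_one₀ hδ.le hδ1
    have : 0 ≤ C * δ := by positivity
    nlinarith
  nlinarith [hx.2]

open MeasureTheory Real

theorem yv_per {d : ℕ} {h : ℝ} (M : ℕ) (hM : 2 * h * M = 2 * π) (f : (Fin d → ℝ) → (Fin d → ℝ))
    (k : Fin d → ℤ) (q : Fin d → ℝ) : f (yy h (sh k q)) = f (yy h q) := by
  rw [yy_per M hM]

theorem sand_good {d : ℕ} {V0 : (Fin d → ℝ) → ℝ} {r : ℝ} {F : ℝ → Phase d → Phase d}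
    {A C h : ℝ} (hF : FreeFlow V0 r F A C) (M : ℕ) (hM : 2 * h * M = 2 * π)
    (f g : (Fin d → ℝ) → (Fin d → ℝ)) (hf : Measurable f) (hg : Measurable g) (t : ℝ) (ht : 0 ≤ t) :
    Good ((ENNReal.ofReal (exp (A * t))) ^ (2 * d))
      (VS (fun q => f (yy h q)) ∘ (F t ∘ VS (fun q => g (yy h q)))) := by
  have h1 := VS_good (hf.comp (yy_meas h)) (yv_per M hM f)
  have h2 := VS_good (hg.comp (yy_meas h)) (yv_per M hM g)
  have := h1.comp ((hF.good t ht).comp h2)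
  rw [one_mul, mul_one] at this
  exact this

theorem sand_DR {d : ℕ} {V0 : (Fin d → ℝ) → ℝ} {r : ℝ} (S : Setup V0 r) {F : ℝ → Phase d → Phase d}
    {A C h : ℝ} (hF : FreeFlow V0 r F A C) (M : ℕ) (hM : 2 * h * M = 2 * π)
    (f g : (Fin d → ℝ) → (Fin d → ℝ)) (hf : Measurable f) (hg : Measurable g) (t : ℝ) (ht : 0 ≤ t) :
    DR V0 r t (VS (fun q => f (yy h q)) ∘ (F t ∘ VS (fun q => g (yy h q)))) := by
  have h1 := VS_good (hf.comp (yy_meas h)) (yv_per M hM f)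
  have h2 := VS_good (hg.comp (yy_meas h)) (yv_per M hM g)
  have d1 := VS_all S _ (hf.comp (yy_meas h)) (yv_per M hM f)
  have d2 := VS_all S _ (hg.comp (yy_meas h)) (yv_per M hM g)
  have := d1.comp S ((hF.dr t ht).comp S d2 (by finiteness) (hF.good t ht) h2) (by simp) h1
    ((hF.good t ht).comp h2)
  rw [zero_add, add_zero] at this
  exact this

open Filter Topology in
theorem HS_step {d : ℕ} {V0 : (Fin d → ℝ) → ℝ} {r : ℝ} (S : Setup V0 r) {h : ℝ} (hh : 0 < h) (M : ℕ)
    (hM : 2 * h * M = 2 * π) (v : (Fin d → ℝ) → (Fin d → ℝ)) (hvm : Measurable v)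
    (hv : ∀ p, IsLat h (v p))
    (hloc : ∀ᵐ p : Fin d → ℝ, ∃ η > (0 : ℝ), ∀ p', ‖p' - p‖ ≤ η → v p' = v p) :
    DR V0 r 0 (HS v) := by
  obtain ⟨F, A0, C, hF⟩ := exists_free S
  have hC := hF.hC
  let s : ℕ → ℝ := fun n => ((n : ℝ) + 1)⁻¹
  have hs0 : ∀ n, 0 < s n := s_pos
  have hs1 : ∀ n, s n ≤ 1 := s_le
  have hs : Tendsto s atTop (𝓝 0) := tendsto_s
  let E : ℝ → ENNReal := fun t => (ENNReal.ofReal (exp (A0 * t))) ^ (2 * d)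
  have hE : ∀ t, E t ≠ ⊤ := fun t => by simp only [E]; finiteness
  have mS : ∀ a : ℝ, Measurable (fun y : Fin d → ℝ => a • y) := fun a => measurable_const_smul a
  have gS : ∀ n, Good (E (s n)) (SS h F (s n)) := fun n =>
    sand_good hF M hM (fun y => (-(s n)⁻¹) • y) (fun y => (-(s n)⁻¹) • y)
      (mS _) (mS _) (s n) (hs0 n).le
  have dS : ∀ n, DR V0 r (s n) (SS h F (s n)) := fun n =>
    sand_DR S hF M hM (fun y => (-(s n)⁻¹) • y) (fun y => (-(s n)⁻¹) • y)
      (mS _) (mS _) (s n) (hs0 n).le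
  have mX : ∀ a b : ℝ, Measurable (fun y : Fin d → ℝ => a • v (b • y)) := fun a b =>
    (hvm.comp (mS b)).const_smul a
  have hs3 : ∀ n, 0 ≤ s n ^ 3 := fun n => pow_nonneg (hs0 n).le 3
  have gX : ∀ n, Good (E (s n ^ 3)) (XX h v F (s n)) := fun n =>
    sand_good hF M hM (fun y => (-(s n ^ 3)⁻¹) • v ((s n)⁻¹ • y)) (fun y => ((s n ^ 3)⁻¹) • v ((s n)⁻¹ • y))
      (mX _ _) (mX _ _) (s n ^ 3) (hs3 n)
  have dX : ∀ n, DR V0 r (s n ^ 3) (XX h v F (s n)) := fun n =>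
    sand_DR S hF M hM (fun y => (-(s n ^ 3)⁻¹) • v ((s n)⁻¹ • y)) (fun y => ((s n ^ 3)⁻¹) • v ((s n)⁻¹ • y))
      (mX _ _) (mX _ _) (s n ^ 3) (hs3 n)
  have hEs : Tendsto (fun n => E (s n)) atTop (𝓝 1) := const_tendsto _ (by simpa using hs.const_mul A0) _
  have hEx : Tendsto (fun n => E (s n ^ 3)) atTop (𝓝 1) :=
    const_tendsto _ (by simpa using (hs.pow 3).const_mul A0) _
  have mulT : ∀ {f g : ℕ → ENNReal}, Tendsto f atTop (𝓝 1) → Tendsto g atTop (𝓝 1) →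
      Tendsto (fun n => f n * g n) atTop (𝓝 1) := by
    intro f g hf hg
    simpa using ENNReal.Tendsto.mul hf (by simp) hg (by simp)
  refine DR.limit S (fun n => s n + (s n + (s n + (s n ^ 3 + s n)))) 0
    (by simpa using hs.add (hs.add (hs.add ((hs.pow 3).add hs))))
    (fun n => E (s n) * (E (s n) * (E (s n) * (E (s n ^ 3) * E (s n)))))
    (fun n => SS h F (s n) ∘ (SS h F (s n) ∘ (SS h F (s n) ∘ (XX h v F (s n) ∘ SS h F (s n))))) _
    (fun n => (gS n).comp ((gS n).comp ((gS n).comp ((gX n).comp (gS n)))))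
    (mulT hEs (mulT hEs (mulT hEs (mulT hEx hEs)))) (HS_exact hvm) ?_
    (fun n => (dS n).comp S ((dS n).comp S ((dS n).comp S ((dX n).comp S (dS n) (hE _) (gX n) (gS n))
      (hE _) (gS n) ((gX n).comp (gS n))) (hE _) (gS n) ((gS n).comp ((gX n).comp (gS n)))) (hE _) (gS n)
      ((gS n).comp ((gS n).comp ((gX n).comp (gS n)))))
  apply ae_restrict_of_ae
  have q1 := (Measure.quasiMeasurePreserving_fst (μ := (volume : Measure (Fin d → ℝ)))
    (ν := (volume : Measure (Fin d → ℝ)))).ae (ae_yy (d := d) hh)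
  have q2 := (Measure.quasiMeasurePreserving_snd (μ := (volume : Measure (Fin d → ℝ)))
    (ν := (volume : Measure (Fin d → ℝ)))).ae hloc
  filter_upwards [q1, q2] with x hA hx2
  obtain ⟨η, hη0, hη⟩ := hx2
  set A := yy h x.1 with hAdef
  set p := x.2 with hp
  let L : ℝ := 20 * C + h
  have hL : 0 ≤ L := by positivity
  have t1 : Tendsto (fun n => ‖A‖ + L * s n ^ 2) atTop (𝓝 (‖A‖ + L * 0 ^ 2)) :=
    ((hs.pow 2).const_mul L).const_add _
  have t2 : Tendsto (fun n => ‖s n • p‖ + L * s n ^ 2) atTop (𝓝 (‖(0:ℝ) • p‖ + L * 0 ^ 2)) :=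
    (hs.smul_const p).norm.add ((hs.pow 2).const_mul L)
  have t3 : Tendsto (fun n => L * s n) atTop (𝓝 (L * 0)) := hs.const_mul L
  have f1 := t1.eventually_lt_const (u := h) (by simpa using hA)
  have f2 := t2.eventually_lt_const (u := h) (by simpa using hh)
  have f3 := t3.eventually_lt_const (u := η) (by simpa using hη0)
  have key : ∀ᶠ n in atTop, Near (s n) (11 * C + h) (x.1 - A + v p) A p
      ((SS h F (s n) ∘ (SS h F (s n) ∘ (SS h F (s n) ∘ (XX h v F (s n) ∘ SS h F (s n))))) x) := by
    filter_upwards [f1, f2, f3] with n g1 g2 g3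
    have hδ := hs0 n
    have hδ1 := hs1 n
    generalize s n = δ at hδ hδ1 g1 g2 g3
    have hδ' := hδ.ne'
    have hLK : ∀ K, K ≤ L → K * δ ^ 2 ≤ L * δ ^ 2 := fun K hK =>
      mul_le_mul_of_nonneg_right hK (sq_nonneg δ)
    have L1 : ∀ K, K ≤ L → ‖A‖ + K * δ ^ 2 < h := fun K hK => by linarith [hLK K hK]
    have L2 : ∀ K, K ≤ L → ‖δ • p‖ + K * δ ^ 2 < h := fun K hK => by linarith [hLK K hK]
    have hc : IsLat h (x.1 - A) := yy_lat h x.1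
    have hc2 : IsLat h (x.1 - A + v p) := hc.add (hv p)
    have n0 : Near δ 0 (x.1 - A) A p x := by
      constructor
      · simp
      · simp [hp]
    have n1 := SS_near hF hh hδ hc n0 (L1 _ hL) (L2 _ (by simp only [L]; linarith))
    have n2 := XX_near hF hh hδ hδ1 (by linarith) hv hc n1 hA (L2 _ (by simp only [L]; linarith)) hη (by
      refine le_trans ?_ g3.le
      apply mul_le_mul_of_nonneg_right _ hδ.le
      simp only [L]; linarith)
    have e1 : δ • (-(δ⁻¹ • A)) = -A := by
      rw [smul_neg, smul_smul, mul_inv_cancel₀ hδ', one_smul]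
    have e2 : δ⁻¹ • (δ • p) = p := by
      rw [smul_smul, inv_mul_cancel₀ hδ', one_smul]
    have n3 := SS_near hF hh hδ hc2 n2 (L2 _ (by simp only [L]; linarith)) (by
      rw [e1, norm_neg]; exact L1 _ (by simp only [L]; linarith))
    rw [e1, e2] at n3
    have n4 := SS_near hF hh hδ hc2 n3 (by
      rw [norm_neg]; exact L1 _ (by simp only [L]; linarith)) (by
      rw [smul_neg, norm_neg]; exact L2 _ (by simp only [L]; linarith))
    have e3 : -(δ⁻¹ • -A) = δ⁻¹ • A := by rw [smul_neg, neg_neg]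
    have e4 : δ • (δ⁻¹ • A) = A := by
      rw [smul_smul, mul_inv_cancel₀ hδ', one_smul]
    have e5 : -(δ⁻¹ • (δ • -p)) = p := by
      rw [smul_smul, inv_mul_cancel₀ hδ', one_smul, neg_neg]
    rw [e3] at n4
    have n5 := SS_near hF hh hδ hc2 n4 (by
      rw [smul_neg, norm_neg]; exact L2 _ (by simp only [L]; linarith)) (by
      rw [e4]; exact L1 _ (by simp only [L]; linarith))
    rw [e4, e5] at n5
    have e6 : 2 * (0 + 2 * C) + h + C + 2 * C + 2 * C + 2 * C = 11 * C + h := by ring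
    rw [e6] at n5
    exact n5
  have hlim1 : Tendsto (fun n => (11 * C + h) * s n ^ 2) atTop (𝓝 0) := by
    simpa using (hs.pow 2).const_mul (11 * C + h)
  have hlim2 : Tendsto (fun n => (11 * C + h) * s n) atTop (𝓝 0) := by
    simpa using hs.const_mul (11 * C + h)
  have r1 := squeeze_zero_norm' (key.mono fun n hn => hn.1) hlim1
  have r2 := squeeze_zero_norm' (key.mono fun n hn => hn.2) hlim2
  have g1 : ∀ y a b w : Fin d → ℝ, y - (a - b + w) - b + (a + w) = y := fun y a b w => by abel
  apply Tendsto.prodMk_nhds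
  · have := r1.add_const (x.1 + v p)
    rw [zero_add] at this
    exact this.congr fun n => g1 _ _ _ _
  · have := r2.add_const p
    rw [zero_add] at this
    exact this.congr fun n => sub_add_cancel _ _

open MeasureTheory Real

/-- the gradient -/
noncomputable def gr {d : ℕ} (g : (Fin d → ℝ) → ℝ) (p : Fin d → ℝ) : Fin d → ℝ :=
  fun i => fderiv ℝ g p (Pi.single i 1)

/-- grid rounding -/
noncomputable def grid {d : ℕ} (s : ℝ) (p : Fin d → ℝ) : Fin d → ℝ :=
  fun i => s * (round (p i / s) : ℝ)

theorem grid_meas {d : ℕ} (s : ℝ) : Measurable (grid (d := d) s) := by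
  refine measurable_pi_iff.2 fun i => ?_
  exact (measurable_round'.comp ((measurable_pi_apply i).div_const _)).const_mul _

theorem grid_near {d : ℕ} {s : ℝ} (hs : 0 < s) (p : Fin d → ℝ) : ‖grid s p - p‖ ≤ s := by
  rw [pi_norm_le_iff_of_nonneg hs.le]
  intro i
  have e : (grid s p - p) i = -(s * (p i / s - round (p i / s))) := by
    simp only [grid, Pi.sub_apply]; field_simp; ring
  rw [e, norm_neg, Real.norm_eq_abs, abs_mul, abs_of_pos hs]
  have := abs_sub_round (p i / s)
  nlinarith

theorem grid_loc {d : ℕ} {s : ℝ} (hs : 0 < s) : ∀ᵐ p : Fin d → ℝ, ∃ η > (0 : ℝ),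
    ∀ p', ‖p' - p‖ ≤ η → grid s p' = grid s p := by
  filter_upwards [ae_all_iff.2 fun i : Fin d => ae_round i s hs.ne'] with p hp
  have h1 : ∀ i, ∃ η > (0 : ℝ), ∀ y : ℝ, |y - p i| ≤ η → round (y / s) = round (p i / s) := by
    intro i
    refine ⟨s * ((1 / 2 - |p i / s - round (p i / s)|) / 2), ?_, ?_⟩
    · have := hp i
      apply mul_pos hs
      linarith
    · intro y hy
      apply round_of_near
      have e : y / s - round (p i / s) = (y - p i) / s + (p i / s - round (p i / s)) := by ring
      rw [e]
      refine (abs_add_le _ _).trans_lt ?_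
      rw [abs_div, abs_of_pos hs]
      have : |y - p i| / s ≤ (1 / 2 - |p i / s - round (p i / s)|) / 2 := by
        rw [div_le_iff₀ hs]; linarith
      linarith [hp i]
  choose η hη0 hη using h1
  obtain ⟨m, hm0, hm⟩ : ∃ m > (0 : ℝ), ∀ i, m ≤ η i := by
    rcases isEmpty_or_nonempty (Fin d) with he | he
    · exact ⟨1, one_pos, fun i => he.elim i⟩
    · obtain ⟨i0, hi0⟩ := Finite.exists_min η
      exact ⟨η i0, hη0 _, hi0⟩
  refine ⟨m, hm0, fun p' hp' => ?_⟩
  funext i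
  simp only [grid]
  rw [hη i (p' i)]
  exact ((norm_le_pi_norm (p' - p) i).trans hp').trans (hm i)

open Filter Topology in
theorem HS_gr {d : ℕ} {V0 : (Fin d → ℝ) → ℝ} {r : ℝ} (S : Setup V0 r) (G : (Fin d → ℝ) → (Fin d → ℝ))
    (hG : Continuous G) : DR V0 r 0 (HS G) := by
  let s : ℕ → ℝ := fun n => ((n : ℝ) + 1)⁻¹
  have hs0 : ∀ n, 0 < s n := s_pos
  have hs : Tendsto s atTop (𝓝 0) := tendsto_s
  let h : ℕ → ℝ := fun n => π * s n
  have hh : ∀ n, 0 < h n := fun n => mul_pos pi_pos (hs0 n)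
  let v : ℕ → (Fin d → ℝ) → (Fin d → ℝ) := fun n p => grid (2 * h n) (G (grid (s n) p))
  have hvm : ∀ n, Measurable (v n) := fun n =>
    (grid_meas _).comp (hG.measurable.comp (grid_meas _))
  have hDR : ∀ n, DR V0 r 0 (HS (v n)) := by
    intro n
    refine HS_step S (hh n) (n + 1) ?_ (v n) (hvm n) (fun p => ⟨_, rfl⟩) ?_
    · simp only [h, s]; push_cast; field_simp
    · filter_upwards [grid_loc (d := d) (hs0 n)] with p hp
      obtain ⟨η, h0, hη⟩ := hp
      exact ⟨η, h0, fun p' hp' => by simp only [v, hη p' hp']⟩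
  refine DR.limit S (fun _ => 0) 0 tendsto_const_nhds (fun _ => 1) (fun n => HS (v n)) _
    (fun n => HS_good (hvm n)) tendsto_const_nhds (HS_exact hG.measurable) ?_ hDR
  refine Eventually.of_forall fun x => ?_
  have l1 : Tendsto (fun n => grid (s n) x.2) atTop (𝓝 x.2) :=
    tendsto_of_norm_le tendsto_const_nhds hs (fun n => grid_near (hs0 n) x.2)
  have l2 : Tendsto (fun n => G (grid (s n) x.2)) atTop (𝓝 (G x.2)) := (hG.tendsto _).comp l1
  have l3 : Tendsto (fun n => v n x.2) atTop (𝓝 (G x.2)) :=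
    tendsto_of_norm_le (b := fun n => 2 * h n) l2 (by simpa [h] using (hs.const_mul π).const_mul 2)
      (fun n => grid_near (by linarith [hh n]) _)
  exact (l3.const_add x.1).prodMk_nhds tendsto_const_nhds

theorem hshear_DR {d : ℕ} {V0 : (Fin d → ℝ) → ℝ} {r : ℝ} (S : Setup V0 r) (g : (Fin d → ℝ) → ℝ)
    (hg : ContDiff ℝ (⊤ : ℕ∞) g) : DR V0 r 0 (hshear g) := by
  refine HS_gr S (fun p i => fderiv ℝ g p (Pi.single i 1)) ?_
  refine continuous_pi fun i => ?_
  exact (hg.continuous_fderiv (by simp)).clm_apply continuous_const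

/-- **Theorem (horizontal shears on `T*𝕋^d` are reachable at the level of densities).**
For the torus control system (lifted to `ℝ^d × ℝ^d`)
`H_u(q,p) = |p|²/2 + V_0(q) + Σ_{j=1}^d (u_{2j−1} cos(k_j·q) + u_{2j} sin(k_j·q))` with
`V_0` smooth and `2π`-periodic: for every `r ∈ [1,∞)`, every torus density `ρ0`, every
`g ∈ C^∞(ℝ^d,ℝ)` and every `ε > 0`, there are `τ ∈ [0,ε]` and a piecewise constant control
realizing a flow map `Φ^τ_{H_u}` with `‖ρ0 ∘ Φ^τ_{H_u} − ρ0 ∘ T_g‖_{L^r(Q)} < ε`, where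
`T_g(q,p) = (q + ∇g(p), p)` and `Q = [0,2π)^d × ℝ^d`. -/
theorem torus_horizontal_shears_reachable_on_densities
    (d : ℕ) (V0 : (Fin d → ℝ) → ℝ) (hV0 : ContDiff ℝ (⊤ : ℕ∞) V0)
    (hper : ∀ (q : Fin d → ℝ) (k : Fin d → ℤ),
      V0 (fun i => q i + 2 * Real.pi * (k i)) = V0 q)
    (r : ℝ) (hr : 1 ≤ r) (ρ0 : Phase d → ℝ)
    (hρ0 : IsTorusDensity (ENNReal.ofReal r) ρ0)
    (g : (Fin d → ℝ) → ℝ) (hg : ContDiff ℝ (⊤ : ℕ∞) g) :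
    ∀ ε > (0:ℝ), ∃ τ ∈ Set.Icc (0:ℝ) ε, ∃ Φ : Phase d → Phase d,
      Reachable (torusHam V0) τ Φ ∧
      eLpNorm (fun x => ρ0 (Φ x) - ρ0 (hshear g x)) (ENNReal.ofReal r)
          (volume.restrict (torusBlock d))
        < ENNReal.ofReal ε := by
  intro ε hε
  obtain ⟨τ, h0, h1, h2⟩ := hshear_DR (⟨hV0, hper, hr⟩ : Setup V0 r) g hg ρ0 hρ0 ε hε
  exact ⟨τ, ⟨h0, by linarith⟩, h2⟩
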